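/- arXiv:2109.06833 — 6 statements merged into one kernel-verified Lean document; each statement's English description precedes it below -/
import Mathlib

section
/- Let r₁,…,rₙ be distinct roots of the characteristic equation P(z)=0 with Re r_k > 0 for all 1 ≤ k ≤ n, and let K = (1/|V|)∫₀^∞ |Σ_{k=1}^n (−1)^k V_k e^{−r_k x}| dx. Then for every ε > 0 and every y ∈ Cⁿ(ℝ,X) with ‖D(y)(t)‖ ≤ ε for all t ∈ ℝ, there exists y_H ∈ Ker D such that ‖y(t) − y_H(t)‖ ≤ Kε for all t ∈ ℝ. -/
open MeasureTheory

/-- The linear differential operator `D(y) = y⁽ⁿ⁾ + a₁ y⁽ⁿ⁻¹⁾ + ⋯ + aₙ y`,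
where `a j` is the coefficient of `y⁽ⁿ⁻¹⁻ʲ⁾` (zero-based indexing). -/
noncomputable def Dop {X : Type*} [NormedAddCommGroup X] [NormedSpace ℂ X]
    (n : ℕ) (a : Fin n → ℂ) (y : ℝ → X) : ℝ → X :=
  fun t => iteratedDeriv n y t + ∑ j : Fin n, a j • iteratedDeriv (n - 1 - (j : ℕ)) y t

/-- Vandermonde determinant of `r₁, …, rₙ` with the `k`-th entry deleted. -/
noncomputable def VandDel {n : ℕ} (r : Fin (n + 1) → ℂ) (k : Fin (n + 1)) : ℂ :=
  (Matrix.vandermonde fun i : Fin n => r (k.succAbove i)).det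

/-- The alternating sum of the complementary minors of a Vandermonde matrix against `m`-th powers
is the determinant obtained by replacing its last column. -/
theorem sum_pow_mul_vandDel {n : ℕ} (r : Fin (n + 1) → ℂ) (m : ℕ) :
    ∑ k : Fin (n + 1), (-1 : ℂ) ^ ((k : ℕ) + n) * VandDel r k * r k ^ m =
      ((Matrix.vandermonde r).updateCol (Fin.last n) fun k => r k ^ m).det := by
  rw [Matrix.det_succ_column _ (Fin.last n)]
  refine Finset.sum_congr rfl fun k _ => ?_
  have h : (((Matrix.vandermonde r).updateCol (Fin.last n) fun k => r k ^ m).submatrix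
      k.succAbove (Fin.last n).succAbove) = Matrix.vandermonde fun i => r (k.succAbove i) := by
    ext i j
    simp [Matrix.vandermonde_apply, (Fin.castSucc_lt_last j).ne]
  rw [h, VandDel, Matrix.updateCol_self, Fin.val_last]
  ring

theorem sum_pow_mul_vandDel_of_lt {n : ℕ} (r : Fin (n + 1) → ℂ) {m : ℕ} (hm : m < n) :
    ∑ k : Fin (n + 1), (-1 : ℂ) ^ ((k : ℕ) + n) * VandDel r k * r k ^ m = 0 := by
  rw [sum_pow_mul_vandDel]
  have hne : (⟨m, by omega⟩ : Fin (n + 1)) ≠ Fin.last n := by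
    simp [Fin.ext_iff, hm.ne]
  refine Matrix.det_zero_of_column_eq hne fun i => ?_
  simp [hne, Matrix.vandermonde_apply]

theorem sum_pow_mul_vandDel_self {n : ℕ} (r : Fin (n + 1) → ℂ) :
    ∑ k : Fin (n + 1), (-1 : ℂ) ^ ((k : ℕ) + n) * VandDel r k * r k ^ n = (Matrix.vandermonde r).det := by
  rw [sum_pow_mul_vandDel]
  congr 1
  ext i j
  by_cases hj : j = Fin.last n
  · simp [hj, Matrix.vandermonde_apply]
  · simp [hj]

theorem integrableOn_exp_neg_mul_Ioi {c : ℂ} (hc : 0 < c.re) (s : ℝ) :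
    IntegrableOn (fun x : ℝ => Complex.exp (-c * x)) (Set.Ioi s) :=
  integrableOn_exp_mul_complex_Ioi (by simpa using hc) s

section BoundedSolution

variable {X : Type*} [NormedAddCommGroup X] [NormedSpace ℂ X]

theorem integrableOn_exp_smul_Ioi {c : ℂ} (hc : 0 < c.re) {f : ℝ → X} (hf : Continuous f)
    {C : ℝ} (hC : ∀ t, ‖f t‖ ≤ C) (s : ℝ) :
    IntegrableOn (fun x : ℝ => Complex.exp (-c * x) • f x) (Set.Ioi s) :=
  (integrableOn_exp_neg_mul_Ioi hc s).smul_bdd C hf.aestronglyMeasurable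
    (Filter.Eventually.of_forall hC)

/-- The bounded solution of the equation `du/dt = c u + f` for bounded `f` and `0 < re c`. -/
noncomputable def boundedSol (c : ℂ) (f : ℝ → X) (t : ℝ) : X :=
  -∫ x in Set.Ioi (0 : ℝ), Complex.exp (-c * x) • f (t + x)

theorem boundedSol_eq (c : ℂ) (f : ℝ → X) (t : ℝ) :
    boundedSol c f t =
      -(Complex.exp (c * t) • ∫ s in Set.Ioi t, Complex.exp (-c * s) • f s) := by
  have h := (measurePreserving_add_right volume t).setIntegral_preimage_emb
    (measurableEmbedding_addRight t) (fun s : ℝ => Complex.exp (-c * s) • f s) (Set.Ioi t)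
  rw [Set.preimage_add_const_Ioi, sub_self] at h
  rw [boundedSol, ← h, ← integral_smul]
  congr 2
  ext x
  rw [smul_smul, ← Complex.exp_add, add_comm t x]
  congr 2
  push_cast
  ring

theorem hasDerivAt_boundedSol [CompleteSpace X] {c : ℂ} (hc : 0 < c.re) {f : ℝ → X}
    (hf : Continuous f) {C : ℝ} (hC : ∀ t, ‖f t‖ ≤ C) (t : ℝ) :
    HasDerivAt (boundedSol c f) (c • boundedSol c f t + f t) t := by
  set g : ℝ → X := fun s => Complex.exp (-c * s) • f s with hg
  have hgc : Continuous g := by fun_prop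
  have htail : ∀ s, ∫ x in Set.Ioi s, g x = (∫ x in Set.Ioi 0, g x) - ∫ x in (0 : ℝ)..s, g x :=
    fun s => by
      rw [eq_sub_iff_add_eq', intervalIntegral.integral_interval_add_Ioi'
        (hgc.intervalIntegrable 0 s) (integrableOn_exp_smul_Ioi hc hf hC s)]
  have hI : HasDerivAt (fun s => ∫ x in Set.Ioi s, g x) (-g t) t := by
    rw [funext htail]
    exact (intervalIntegral.integral_hasDerivAt_right (hgc.intervalIntegrable 0 t)
      (hgc.stronglyMeasurableAtFilter _ _) hgc.continuousAt).const_sub _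
  have hE : HasDerivAt (fun s : ℝ => Complex.exp (c * s)) (Complex.exp (c * t) * c) t := by
    simpa using ((Complex.ofRealCLM.hasDerivAt (x := t)).const_mul c).cexp
  have key := (hE.smul hI).neg
  rw [funext (boundedSol_eq c f)]
  refine key.congr_deriv ?_
  have h1 : Complex.exp (c * t) • g t = f t := by
    rw [hg, smul_smul, ← Complex.exp_add]
    simp
  beta_reduce
  rw [smul_neg, h1, smul_neg, smul_smul, mul_comm c (Complex.exp _), neg_add_rev, neg_neg]

end BoundedSolution

section ParticularSolution

variable {X : Type*} [NormedAddCommGroup X] [NormedSpace ℂ X]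

theorem hasDerivAt_sum_pow_smul {ι : Type*} [Fintype ι] {c r : ι → ℂ} {u : ι → ℝ → X}
    {f : ℝ → X} (hu : ∀ k t, HasDerivAt (u k) (r k • u k t + f t) t) (m : ℕ) (t : ℝ) :
    HasDerivAt (fun t => ∑ k, (c k * r k ^ m) • u k t)
      (∑ k, (c k * r k ^ (m + 1)) • u k t + (∑ k, c k * r k ^ m) • f t) t := by
  refine (HasDerivAt.fun_sum fun k _ => (hu k t).const_smul (c k * r k ^ m)).congr_deriv ?_
  rw [Finset.sum_smul, ← Finset.sum_add_distrib]
  refine Finset.sum_congr rfl fun k _ => ?_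
  rw [smul_add, smul_smul, pow_succ, mul_assoc]

/-- If each `u k` has derivative `r k • u k + f` and the moments `∑ c k * r k ^ m` vanish for `m < n`, then
the first `n` derivatives of `∑ c k • u k` do not involve `f`. -/
theorem iteratedDeriv_sum_smul {n : ℕ} {ι : Type*} [Fintype ι] {c r : ι → ℂ}
    {u : ι → ℝ → X} {f : ℝ → X} (hu : ∀ k t, HasDerivAt (u k) (r k • u k t + f t) t)
    (h0 : ∀ m < n, ∑ k, c k * r k ^ m = 0) {m : ℕ} (hm : m ≤ n) :
    iteratedDeriv m (fun t => ∑ k, c k • u k t) = fun t => ∑ k, (c k * r k ^ m) • u k t := by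
  induction m with
  | zero => simp
  | succ m ih =>
    rw [iteratedDeriv_succ, ih (by omega)]
    ext t
    rw [(hasDerivAt_sum_pow_smul hu m t).deriv, h0 m (by omega), zero_smul, add_zero]

theorem iteratedDeriv_succ_sum_smul {n : ℕ} {ι : Type*} [Fintype ι] {c r : ι → ℂ}
    {u : ι → ℝ → X} {f : ℝ → X} (hu : ∀ k t, HasDerivAt (u k) (r k • u k t + f t) t)
    (h0 : ∀ m < n, ∑ k, c k * r k ^ m = 0) (h1 : ∑ k, c k * r k ^ n = 1) :
    iteratedDeriv (n + 1) (fun t => ∑ k, c k • u k t) =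
      fun t => ∑ k, (c k * r k ^ (n + 1)) • u k t + f t := by
  rw [iteratedDeriv_succ, iteratedDeriv_sum_smul hu h0 le_rfl]
  ext t
  rw [(hasDerivAt_sum_pow_smul hu n t).deriv, h1, one_smul]

theorem contDiff_sum_smul {n : ℕ} {ι : Type*} [Fintype ι] {c r : ι → ℂ}
    {u : ι → ℝ → X} {f : ℝ → X} (hf : Continuous f)
    (hu : ∀ k t, HasDerivAt (u k) (r k • u k t + f t) t)
    (h0 : ∀ m < n, ∑ k, c k * r k ^ m = 0) (h1 : ∑ k, c k * r k ^ n = 1) :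
    ContDiff ℝ (n + 1) (fun t => ∑ k, c k • u k t) := by
  have huc : ∀ k, Continuous (u k) := fun k =>
    continuous_iff_continuousAt.2 fun t => (hu k t).continuousAt
  rw [← Nat.cast_add_one, contDiff_nat_iff_iteratedDeriv]
  refine ⟨fun m hm => ?_, fun m hm => ?_⟩
  · rcases Nat.lt_or_ge n m with h | h
    · obtain rfl : m = n + 1 := by omega
      rw [iteratedDeriv_succ_sum_smul hu h0 h1]
      fun_prop
    · rw [iteratedDeriv_sum_smul hu h0 h]
      fun_prop
  · rw [iteratedDeriv_sum_smul hu h0 (by omega)]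
    exact fun t => (hasDerivAt_sum_pow_smul hu m t).differentiableAt

theorem Dop_sum_smul {n : ℕ} {ι : Type*} [Fintype ι] {a : Fin (n + 1) → ℂ} {c r : ι → ℂ}
    {u : ι → ℝ → X} {f : ℝ → X}
    (hroot : ∀ k, r k ^ (n + 1) + ∑ j : Fin (n + 1), a j * r k ^ (n - (j : ℕ)) = 0)
    (hu : ∀ k t, HasDerivAt (u k) (r k • u k t + f t) t)
    (h0 : ∀ m < n, ∑ k, c k * r k ^ m = 0) (h1 : ∑ k, c k * r k ^ n = 1) :
    Dop (n + 1) a (fun t => ∑ k, c k • u k t) = f := by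
  ext t
  have hlow : ∀ j : Fin (n + 1), iteratedDeriv (n + 1 - 1 - (j : ℕ)) (fun t => ∑ k, c k • u k t) t
      = ∑ k, (c k * r k ^ (n - (j : ℕ))) • u k t := fun j => by
    rw [iteratedDeriv_sum_smul hu h0 (by omega), Nat.add_sub_cancel]
  simp only [Dop, hlow, iteratedDeriv_succ_sum_smul hu h0 h1, Finset.smul_sum, smul_smul]
  rw [Finset.sum_comm, add_right_comm, ← Finset.sum_add_distrib]
  simp only [← Finset.sum_smul, ← add_smul]
  rw [Finset.sum_eq_zero, zero_add]
  intro k _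
  have h : c k * r k ^ (n + 1) + ∑ j : Fin (n + 1), a j * (c k * r k ^ (n - (j : ℕ))) = 0 := by
    rw [← mul_zero (c k), ← hroot k, mul_add, Finset.mul_sum]
    simp only [mul_left_comm]
  rw [h, zero_smul]

theorem continuous_Dop {n : ℕ} (a : Fin (n + 1) → ℂ) {y : ℝ → X} (hy : ContDiff ℝ (n + 1) y) :
    Continuous (Dop (n + 1) a y) := by
  have h : ∀ m ≤ n + 1, Continuous (iteratedDeriv m y) := fun m hm =>
    hy.continuous_iteratedDeriv m (by exact_mod_cast hm)
  exact (h _ le_rfl).add (continuous_finsetSum _ fun j _ => (h _ (by omega)).const_smul (a j))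

theorem Dop_sub {n : ℕ} (a : Fin (n + 1) → ℂ) {y z : ℝ → X} (hy : ContDiff ℝ (n + 1) y)
    (hz : ContDiff ℝ (n + 1) z) : Dop (n + 1) a (y - z) = Dop (n + 1) a y - Dop (n + 1) a z := by
  ext t
  have h : ∀ m ≤ n + 1, iteratedDeriv m (y - z) t = iteratedDeriv m y t - iteratedDeriv m z t :=
    fun m hm => iteratedDeriv_sub (hy.of_le (by exact_mod_cast hm)).contDiffAt
      (hz.of_le (by exact_mod_cast hm)).contDiffAt
  simp only [Dop, Pi.sub_apply, h _ le_rfl]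
  rw [Finset.sum_congr rfl fun j _ => by rw [h (n + 1 - 1 - (j : ℕ)) (by omega), smul_sub],
    Finset.sum_sub_distrib]
  abel

/-- A linear combination of bounded solutions is bounded by the `L¹` norm of the combined kernel. -/
theorem norm_sum_smul_boundedSol_le {ι : Type*} [Fintype ι] (c : ι → ℂ) {r : ι → ℂ}
    (hr : ∀ k, 0 < (r k).re) {f : ℝ → X} (hf : Continuous f) {C : ℝ} (hC : ∀ t, ‖f t‖ ≤ C)
    (t : ℝ) :
    ‖∑ k, c k • boundedSol (r k) f t‖ ≤
      (∫ x in Set.Ioi (0 : ℝ), ‖∑ k, c k * Complex.exp (-(r k) * x)‖) * C := by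
  have hint : ∀ k, IntegrableOn (fun x : ℝ => c k • Complex.exp (-(r k) * x) • f (t + x))
      (Set.Ioi 0) := fun k =>
    ((integrableOn_exp_neg_mul_Ioi (hr k) 0).smul_bdd C
      (hf.comp (continuous_const_add t)).aestronglyMeasurable
      (Filter.Eventually.of_forall fun x => hC (t + x))).smul (c k)
  have hG : IntegrableOn (fun x : ℝ => ∑ k, c k * Complex.exp (-(r k) * x)) (Set.Ioi 0) :=
    integrable_finsetSum _ fun k _ => (integrableOn_exp_neg_mul_Ioi (hr k) 0).const_mul (c k)
  have heq : ∑ k, c k • boundedSol (r k) f t =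
      -∫ x in Set.Ioi (0 : ℝ), (∑ k, c k * Complex.exp (-(r k) * x)) • f (t + x) := by
    simp only [boundedSol, smul_neg, Finset.sum_neg_distrib, ← integral_smul]
    rw [← integral_finsetSum _ fun k _ => hint k]
    simp only [Finset.sum_smul, mul_smul]
  rw [heq, norm_neg, ← integral_mul_const]
  refine norm_integral_le_of_norm_le (hG.norm.mul_const C) (Filter.Eventually.of_forall fun x => ?_)
  rw [norm_smul]
  exact mul_le_mul_of_nonneg_left (hC _) (norm_nonneg _)

end ParticularSolution

theorem stmt0 {X : Type*} [NormedAddCommGroup X] [NormedSpace ℂ X] [CompleteSpace X]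
    (n : ℕ) (a : Fin (n + 1) → ℂ) (r : Fin (n + 1) → ℂ)
    (hroot : ∀ k, r k ^ (n + 1) + ∑ j : Fin (n + 1), a j * r k ^ (n - (j : ℕ)) = 0)
    (hinj : Function.Injective r)
    (hre : ∀ k, 0 < (r k).re)
    (K : ℝ)
    (hK : K = (1 / ‖(Matrix.vandermonde r).det‖) *
      ∫ x in Set.Ioi (0 : ℝ), ‖∑ k : Fin (n + 1), (-1 : ℂ) ^ ((k : ℕ) + 1) *
        VandDel r k * Complex.exp (-(r k) * x)‖)
    (ε : ℝ) (hε : 0 < ε)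
    (y : ℝ → X) (hy : ContDiff ℝ (n + 1) y)
    (hbound : ∀ t : ℝ, ‖Dop (n + 1) a y t‖ ≤ ε) :
    ∃ yH : ℝ → X, ContDiff ℝ (n + 1) yH ∧ Dop (n + 1) a yH = 0 ∧
      ∀ t : ℝ, ‖y t - yH t‖ ≤ K * ε := by
  set V := (Matrix.vandermonde r).det
  have hV : V ≠ 0 := Matrix.det_vandermonde_ne_zero_iff.2 hinj
  set f := Dop (n + 1) a y
  have hf : Continuous f := continuous_Dop a hy
  let c : Fin (n + 1) → ℂ := fun k => (-1 : ℂ) ^ ((k : ℕ) + n) * VandDel r k / V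
  have hmoment : ∀ m, ∑ k, c k * r k ^ m =
      (∑ k : Fin (n + 1), (-1 : ℂ) ^ ((k : ℕ) + n) * VandDel r k * r k ^ m) / V := fun m => by
    simp only [c, div_mul_eq_mul_div, Finset.sum_div]
  have h0 : ∀ m < n, ∑ k, c k * r k ^ m = 0 := fun m hm => by
    rw [hmoment, sum_pow_mul_vandDel_of_lt r hm, zero_div]
  have h1 : ∑ k, c k * r k ^ n = 1 := by
    rw [hmoment, sum_pow_mul_vandDel_self, div_self hV]
  have hu : ∀ k t, HasDerivAt (boundedSol (r k) f) (r k • boundedSol (r k) f t + f t) t :=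
    fun k => hasDerivAt_boundedSol (hre k) hf hbound
  have hp := contDiff_sum_smul hf hu h0 h1
  refine ⟨y - fun t => ∑ k, c k • boundedSol (r k) f t, hy.sub hp, ?_, fun t => ?_⟩
  · rw [Dop_sub a hy hp, Dop_sum_smul hroot hu h0 h1, sub_self]
  · rw [Pi.sub_apply, sub_sub_cancel]
    refine (norm_sum_smul_boundedSol_le c hre hf hbound t).trans_eq ?_
    rw [hK, ← integral_const_mul]
    congr 2
    ext x
    have hker : ∑ k, c k * Complex.exp (-(r k) * x) = (-1) ^ (n + 1) / V *
        ∑ k : Fin (n + 1), (-1 : ℂ) ^ ((k : ℕ) + 1) * VandDel r k *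
          Complex.exp (-(r k) * x) := by
      rw [Finset.mul_sum]
      refine Finset.sum_congr rfl fun k _ => ?_
      simp only [c, pow_succ, pow_add]
      ring
    rw [hker, norm_mul, norm_div, norm_pow, norm_neg, norm_one, one_pow]
end

section
/- Let r₁,…,rₙ be distinct roots of the characteristic equation P(z)=0 with Re r_k > 0 for 1 ≤ k ≤ p and Re r_k < 0 for p+1 ≤ k ≤ n (where 1 ≤ p ≤ n−1), and let K = (1/|V|)∫₀^∞ ( |Σ_{k=1}^p (−1)^k V_k e^{−r_k x}| + |Σ_{k=p+1}^n (−1)^k V_k e^{r_k x}| ) dx. Then for every ε > 0 and every y ∈ Cⁿ(ℝ,X) with ‖D(y)(t)‖ ≤ ε for all t ∈ ℝ, there exists y_H ∈ Ker D such that ‖y(t) − y_H(t)‖ ≤ Kε for all t ∈ ℝ. -/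
open MeasureTheory

lemma integrableOn_exp_smul_of_bounded {X : Type*} [NormedAddCommGroup X] [NormedSpace ℂ X]
    {l : ℂ} (hl : l.re < 0) {g : ℝ → X} (hg : Continuous g) {ε : ℝ} (hb : ∀ x, ‖g x‖ ≤ ε) :
    IntegrableOn (fun x : ℝ => Complex.exp (l * x) • g x) (Set.Ioi 0) :=
  Integrable.smul_bdd (integrableOn_exp_mul_complex_Ioi hl 0) ε hg.aestronglyMeasurable
    (Filter.Eventually.of_forall hb)

/-- The bounded solution of `du/dt = l u + f` when `l` has negative real part. -/
lemma hasDerivAt_convolution_exp {X : Type*} [NormedAddCommGroup X] [NormedSpace ℂ X]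
    [CompleteSpace X] {l : ℂ} (hl : l.re < 0) {f : ℝ → X} (hf : Continuous f) {ε : ℝ}
    (hb : ∀ x, ‖f x‖ ≤ ε) (t : ℝ) :
    HasDerivAt (fun t : ℝ => ∫ x in Set.Ioi (0 : ℝ), Complex.exp (l * x) • f (t - x))
      (l • (∫ x in Set.Ioi (0 : ℝ), Complex.exp (l * x) • f (t - x)) + f t) t := by
  set h : ℝ → X := fun s => Complex.exp (-l * s) • f s with h_def
  have hcont : Continuous h := by fun_prop
  have shift : ∀ t x : ℝ, Complex.exp (l * x) • f (t - x) = Complex.exp (l * t) • h (t - x) := by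
    intro t x
    rw [h_def, smul_smul, ← Complex.exp_add]
    congr 2
    push_cast
    ring
  have preim : ∀ t : ℝ, (fun x : ℝ => t - x) ⁻¹' Set.Iio t = Set.Ioi 0 := by
    intro t
    ext x
    simp
  have emb : ∀ t : ℝ, MeasurableEmbedding fun x : ℝ => t - x := fun t =>
    (MeasurableEquiv.subLeft t).measurableEmbedding
  have mp : ∀ t : ℝ, MeasurePreserving (fun x : ℝ => t - x) volume volume := fun t =>
    Measure.measurePreserving_sub_left volume t
  have hint : ∀ t : ℝ, IntegrableOn h (Set.Iic t) := by
    intro t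
    rw [integrableOn_Iic_iff_integrableOn_Iio, ← (mp t).integrableOn_comp_preimage (emb t), preim]
    have hi := integrableOn_exp_smul_of_bounded hl (g := fun x => f (t - x)) (by fun_prop)
      (fun x => hb _)
    simp only [shift] at hi
    exact (integrable_smul_iff (Complex.exp_ne_zero _) _).1 hi
  have key : ∀ t : ℝ, ∫ x in Set.Ioi (0 : ℝ), Complex.exp (l * x) • f (t - x)
      = Complex.exp (l * t) • ((∫ s in Set.Iic (0 : ℝ), h s) + ∫ s in (0 : ℝ)..t, h s) := by
    intro t
    simp only [shift]
    rw [integral_smul, ← intervalIntegral.integral_Iic_sub_Iic (hint 0) (hint t),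
      integral_Iic_eq_integral_Iio (x := t), ← (mp t).setIntegral_preimage_emb (emb t) h (Set.Iio t), preim]
    congr 1
    abel
  have hexp : HasDerivAt (fun t : ℝ => Complex.exp (l * t)) (Complex.exp (l * t) * l) t := by
    have := ((hasDerivAt_id (t : ℂ)).const_mul l).cexp.comp_ofReal
    simpa using this
  have hH : HasDerivAt (fun t : ℝ => (∫ s in Set.Iic (0 : ℝ), h s) + ∫ s in (0 : ℝ)..t, h s)
      (h t) t := (hcont.integral_hasStrictDerivAt 0 t).hasDerivAt.const_add _
  have := hexp.smul hH
  rw [funext key]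
  refine this.congr_deriv ?_
  have hht : Complex.exp (l * t) • h t = f t := by
    simp [h_def, smul_smul, ← Complex.exp_add]
  rw [key, hht, smul_smul, mul_comm l (Complex.exp _), add_comm]

/-- The bounded solution of `du/dt = l u + f` when `l` has positive real part. -/
lemma hasDerivAt_neg_convolution_exp_neg {X : Type*} [NormedAddCommGroup X] [NormedSpace ℂ X]
    [CompleteSpace X] {l : ℂ} (hl : 0 < l.re) {f : ℝ → X} (hf : Continuous f) {ε : ℝ}
    (hb : ∀ x, ‖f x‖ ≤ ε) (t : ℝ) :
    HasDerivAt (fun t : ℝ => -∫ x in Set.Ioi (0 : ℝ), Complex.exp (-l * x) • f (t + x))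
      (l • (-∫ x in Set.Ioi (0 : ℝ), Complex.exp (-l * x) • f (t + x)) + f t) t := by
  have h := hasDerivAt_convolution_exp (l := -l) (by simpa using hl) (f := fun s => f (-s))
    (by fun_prop) (fun x => hb _) (-t)
  have := (h.scomp t (hasDerivAt_neg t)).neg
  simp only [neg_sub, sub_neg_eq_add, neg_neg, Function.comp_def, add_comm _ t] at this
  refine (this.congr_of_eventuallyEq (.of_forall fun s => ?_)).congr_deriv ?_
  · simp [add_comm]
  · simp [add_comm]

lemma sum_vandDel_mul_pow {n : ℕ} (r : Fin (n + 1) → ℂ) {j : ℕ} (hj : j ≤ n) :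
    ∑ k : Fin (n + 1), (-1 : ℂ) ^ ((k : ℕ) + n) * r k ^ j * VandDel r k =
      if j = n then (Matrix.vandermonde r).det else 0 := by
  have hexpand := Matrix.det_succ_column
    ((Matrix.vandermonde r).updateCol (Fin.last n) fun k => r k ^ j) (Fin.last n)
  have hsum : ∑ k : Fin (n + 1), (-1 : ℂ) ^ ((k : ℕ) + n) * r k ^ j * VandDel r k =
      ((Matrix.vandermonde r).updateCol (Fin.last n) fun k => r k ^ j).det := by
    rw [hexpand]
    refine Finset.sum_congr rfl fun k _ => ?_
    rw [Matrix.updateCol_self, Fin.val_last, VandDel]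
    congr 2
    ext i l
    simp [Matrix.vandermonde_apply, (Fin.castSucc_lt_last l).ne]
  rw [hsum]
  split_ifs with h
  · congr 1
    subst h
    ext i l
    by_cases hl : l = Fin.last j
    · simp [hl, Matrix.vandermonde_apply]
    · simp [hl]
  · have hlt : j < n + 1 := by omega
    have hne : (⟨j, hlt⟩ : Fin (n + 1)) ≠ Fin.last n := by simpa [Fin.ext_iff] using h
    refine Matrix.det_zero_of_column_eq hne fun k => ?_
    simp [hne, Matrix.vandermonde_apply]

/-- A combination of solutions of first-order equations whose coefficients satisfy the Lagrange
moment conditions solves the equation of order `n + 1`. -/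
lemma contDiff_and_dop_sum_smul {X : Type*} [NormedAddCommGroup X] [NormedSpace ℂ X]
    {n : ℕ} {a r c : Fin (n + 1) → ℂ}
    (hroot : ∀ k, r k ^ (n + 1) + ∑ j : Fin (n + 1), a j * r k ^ (n - (j : ℕ)) = 0)
    (hc : ∀ j ≤ n, ∑ k, c k * r k ^ j = if j = n then 1 else 0)
    {f : ℝ → X} (hf : Continuous f) {u : Fin (n + 1) → ℝ → X}
    (hu : ∀ k t, HasDerivAt (u k) (r k • u k t + f t) t) :
    ContDiff ℝ (n + 1) (fun t => ∑ k, c k • u k t) ∧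
      Dop (n + 1) a (fun t => ∑ k, c k • u k t) = f := by
  have hder : ∀ (j : ℕ) (t : ℝ), HasDerivAt (fun t => ∑ k, (c k * r k ^ j) • u k t)
      (∑ k, (c k * r k ^ (j + 1)) • u k t + (∑ k, c k * r k ^ j) • f t) t := by
    intro j t
    refine (HasDerivAt.fun_sum fun k _ => (hu k t).const_smul (c k * r k ^ j)).congr_deriv ?_
    simp only [smul_add, Finset.sum_add_distrib, Finset.sum_smul, smul_smul, pow_succ, mul_assoc]
  have hcu : ∀ k, Continuous (u k) := fun k =>
    continuous_iff_continuousAt.2 fun t => (hu k t).continuousAt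
  have hit : ∀ j ≤ n, iteratedDeriv j (fun t => ∑ k, c k • u k t) =
      fun t => ∑ k, (c k * r k ^ j) • u k t := by
    intro j
    induction j with
    | zero => simp
    | succ j ih =>
      intro hj
      rw [iteratedDeriv_succ, ih (by omega)]
      funext t
      rw [(hder j t).deriv, hc j (by omega), if_neg (by omega), zero_smul, add_zero]
  have htop : iteratedDeriv (n + 1) (fun t => ∑ k, c k • u k t) =
      fun t => ∑ k, (c k * r k ^ (n + 1)) • u k t + f t := by
    rw [iteratedDeriv_succ, hit n le_rfl]
    funext t
    rw [(hder n t).deriv, hc n le_rfl, if_pos rfl, one_smul]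
  constructor
  · have : ContDiff ℝ ((n + 1 : ℕ) : WithTop ℕ∞) (fun t => ∑ k, c k • u k t) := by
      rw [contDiff_nat_iff_iteratedDeriv]
      constructor
      · intro m hm
        rcases Nat.lt_or_ge n m with h | h
        · obtain rfl : m = n + 1 := by omega
          rw [htop]
          fun_prop
        · rw [hit m h]
          fun_prop
      · intro m hm
        rw [hit m (by omega)]
        exact fun t => (hder m t).differentiableAt
    exact_mod_cast this
  · funext t
    have hlow : ∀ j : Fin (n + 1), iteratedDeriv (n + 1 - 1 - (j : ℕ))
        (fun t => ∑ k, c k • u k t) t = ∑ k, (c k * r k ^ (n - (j : ℕ))) • u k t := by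
      intro j
      rw [Nat.add_sub_cancel, hit _ (Nat.sub_le _ _)]
    simp only [Dop, htop, hlow, Finset.smul_sum, smul_smul]
    rw [Finset.sum_comm, add_right_comm, ← Finset.sum_add_distrib, add_eq_right]
    refine Finset.sum_eq_zero fun k _ => ?_
    rw [← Finset.sum_smul, ← add_smul]
    have : c k * r k ^ (n + 1) + ∑ j : Fin (n + 1), a j * (c k * r k ^ (n - (j : ℕ))) = 0 := by
      rw [← mul_zero (c k), ← hroot k, mul_add, Finset.mul_sum]
      congr 1
      exact Finset.sum_congr rfl fun j _ => by ring
    rw [this, zero_smul]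

lemma integrableOn_norm_sum_exp {ι : Type*} (s : Finset ι) (d l : ι → ℂ)
    (hl : ∀ k ∈ s, (l k).re < 0) :
    IntegrableOn (fun x : ℝ => ‖∑ k ∈ s, d k * Complex.exp (l k * x)‖) (Set.Ioi 0) :=
  (integrable_finsetSum s fun k hk =>
    (integrableOn_exp_mul_complex_Ioi (hl k hk) 0).const_mul (d k)).norm

lemma norm_sum_smul_integral_exp_le {X : Type*} [NormedAddCommGroup X] [NormedSpace ℂ X]
    {ι : Type*} (s : Finset ι) (d l : ι → ℂ) (hl : ∀ k ∈ s, (l k).re < 0)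
    {g : ℝ → X} (hg : Continuous g) {ε : ℝ} (hb : ∀ x, ‖g x‖ ≤ ε) :
    ‖∑ k ∈ s, d k • ∫ x in Set.Ioi (0 : ℝ), Complex.exp (l k * x) • g x‖ ≤
      (∫ x in Set.Ioi (0 : ℝ), ‖∑ k ∈ s, d k * Complex.exp (l k * x)‖) * ε := by
  have heq : ∑ k ∈ s, d k • ∫ x in Set.Ioi (0 : ℝ), Complex.exp (l k * x) • g x =
      ∫ x in Set.Ioi (0 : ℝ), (∑ k ∈ s, d k * Complex.exp (l k * x)) • g x := by
    simp only [Finset.sum_smul, ← integral_smul, mul_smul]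
    exact (integral_finsetSum s fun k hk =>
      (integrableOn_exp_smul_of_bounded (hl k hk) hg hb).smul (d k)).symm
  rw [heq, ← integral_mul_const]
  refine norm_integral_le_of_norm_le ((integrableOn_norm_sum_exp s d l hl).mul_const ε)
    (.of_forall fun x => ?_)
  rw [norm_smul]
  gcongr
  exact hb x

theorem stmt2 {X : Type*} [NormedAddCommGroup X] [NormedSpace ℂ X] [CompleteSpace X]
    (n : ℕ) (a : Fin (n + 1) → ℂ) (r : Fin (n + 1) → ℂ)
    (hroot : ∀ k, r k ^ (n + 1) + ∑ j : Fin (n + 1), a j * r k ^ (n - (j : ℕ)) = 0)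
    (hinj : Function.Injective r)
    (p : ℕ) (hp1 : 1 ≤ p) (hpn : p ≤ n)
    (hpos : ∀ k : Fin (n + 1), (k : ℕ) < p → 0 < (r k).re)
    (hneg : ∀ k : Fin (n + 1), p ≤ (k : ℕ) → (r k).re < 0)
    (K : ℝ)
    (hK : K = (1 / ‖(Matrix.vandermonde r).det‖) *
      ∫ x in Set.Ioi (0 : ℝ),
        (‖∑ k ∈ Finset.univ.filter (fun k : Fin (n + 1) => (k : ℕ) < p),
            (-1 : ℂ) ^ ((k : ℕ) + 1) * VandDel r k * Complex.exp (-(r k) * x)‖ +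
         ‖∑ k ∈ Finset.univ.filter (fun k : Fin (n + 1) => p ≤ (k : ℕ)),
            (-1 : ℂ) ^ ((k : ℕ) + 1) * VandDel r k * Complex.exp (r k * x)‖))
    (ε : ℝ) (hε : 0 < ε)
    (y : ℝ → X) (hy : ContDiff ℝ (n + 1) y)
    (hbound : ∀ t : ℝ, ‖Dop (n + 1) a y t‖ ≤ ε) :
    ∃ yH : ℝ → X, ContDiff ℝ (n + 1) yH ∧ Dop (n + 1) a yH = 0 ∧
      ∀ t : ℝ, ‖y t - yH t‖ ≤ K * ε := by
  set V := (Matrix.vandermonde r).det with V_def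
  have hV : V ≠ 0 := Matrix.det_vandermonde_ne_zero_iff.2 hinj
  set f := Dop (n + 1) a y with f_def
  have hf : Continuous f := by
    have hcont : ∀ m ≤ n + 1, Continuous (iteratedDeriv m y) := fun m hm =>
      hy.continuous_iteratedDeriv m (by exact_mod_cast hm)
    refine (hcont _ le_rfl).add (continuous_finsetSum _ fun j _ => ?_)
    exact (hcont _ (by omega)).const_smul _
  let S := Finset.univ.filter fun k : Fin (n + 1) => (k : ℕ) < p
  let T := Finset.univ.filter fun k : Fin (n + 1) => p ≤ (k : ℕ)
  let d : Fin (n + 1) → ℂ := fun k => (-1 : ℂ) ^ ((k : ℕ) + 1) * VandDel r k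
  let α : ℂ := (-1) ^ (n + 1) / V
  have hS : ∀ k ∈ S, (-(r k)).re < 0 := fun k hk => by
    simpa using hpos k (Finset.mem_filter.1 hk).2
  have hT : ∀ k ∈ T, (r k).re < 0 := fun k hk => hneg k (Finset.mem_filter.1 hk).2
  let u : Fin (n + 1) → ℝ → X := fun k t =>
    if (k : ℕ) < p then -∫ x in Set.Ioi (0 : ℝ), Complex.exp (-(r k) * x) • f (t + x)
    else ∫ x in Set.Ioi (0 : ℝ), Complex.exp (r k * x) • f (t - x)
  have hu : ∀ k t, HasDerivAt (u k) (r k • u k t + f t) t := by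
    intro k t
    by_cases hk : (k : ℕ) < p
    · simpa only [u, if_pos hk] using hasDerivAt_neg_convolution_exp_neg (hpos k hk) hf hbound t
    · simpa only [u, if_neg hk] using
        hasDerivAt_convolution_exp (hneg k (not_lt.1 hk)) hf hbound t
  have hc : ∀ j ≤ n, ∑ k, (α * d k) * r k ^ j = if j = n then 1 else 0 := by
    intro j hj
    have hterm : ∀ k : Fin (n + 1), (α * d k) * r k ^ j =
        V⁻¹ * ((-1 : ℂ) ^ ((k : ℕ) + n) * r k ^ j * VandDel r k) := by
      intro k
      simp only [α, d, pow_add, pow_one]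
      ring
    simp only [hterm]
    rw [← Finset.mul_sum, sum_vandDel_mul_pow r hj, mul_ite, mul_zero, inv_mul_cancel₀ hV]
  obtain ⟨hwC, hwD⟩ := contDiff_and_dop_sum_smul hroot hc hf hu
  set w : ℝ → X := fun t => ∑ k, (α * d k) • u k t with w_def
  refine ⟨y - w, hy.sub hwC, ?_, fun t => ?_⟩
  · have hsub : ∀ m ≤ n + 1, ∀ t,
        iteratedDeriv m (y - w) t = iteratedDeriv m y t - iteratedDeriv m w t := fun m hm t =>
      iteratedDeriv_sub (hy.contDiffAt.of_le (by exact_mod_cast hm))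
        (hwC.contDiffAt.of_le (by exact_mod_cast hm))
    have hdop : Dop (n + 1) a (y - w) = Dop (n + 1) a y - Dop (n + 1) a w := by
      funext t
      have hlow : ∀ j : Fin (n + 1), iteratedDeriv (n + 1 - 1 - (j : ℕ)) (y - w) t =
          iteratedDeriv (n + 1 - 1 - (j : ℕ)) y t - iteratedDeriv (n + 1 - 1 - (j : ℕ)) w t :=
        fun j => hsub _ (by omega) t
      simp only [Dop, Pi.sub_apply, hsub _ le_rfl, hlow, smul_sub, Finset.sum_sub_distrib]
      abel
    rw [hdop, hwD, sub_self]
  · have hsplit : w t = α • (-(∑ k ∈ S, d k •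
          ∫ x in Set.Ioi (0 : ℝ), Complex.exp (-(r k) * x) • f (t + x)) +
        ∑ k ∈ T, d k • ∫ x in Set.Ioi (0 : ℝ), Complex.exp (r k * x) • f (t - x)) := by
      have hTeq : T = Finset.univ.filter fun k : Fin (n + 1) => ¬ (k : ℕ) < p := by
        simp only [T, not_lt]
      rw [w_def]
      simp only [mul_smul]
      rw [← Finset.smul_sum, ← Finset.sum_filter_add_sum_filter_not Finset.univ
        (fun k : Fin (n + 1) => (k : ℕ) < p), hTeq, ← Finset.sum_neg_distrib]
      congr 2
      · refine Finset.sum_congr rfl fun k hk => ?_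
        simp only [u, if_pos (Finset.mem_filter.1 hk).2, smul_neg]
      · refine Finset.sum_congr rfl fun k hk => ?_
        simp only [u, if_neg (Finset.mem_filter.1 hk).2]
    have hα : ‖α‖ = 1 / ‖V‖ := by simp [α]
    have hSb := norm_sum_smul_integral_exp_le S d (fun k => -(r k)) hS
      (g := fun x => f (t + x)) (by fun_prop) (fun x => hbound _)
    have hTb := norm_sum_smul_integral_exp_le T d r hT
      (g := fun x => f (t - x)) (by fun_prop) (fun x => hbound _)
    rw [Pi.sub_apply, sub_sub_cancel, hsplit, norm_smul, hα, hK, integral_add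
      (integrableOn_norm_sum_exp S d (fun k => -(r k)) hS) (integrableOn_norm_sum_exp T d r hT),
      mul_assoc, add_mul]
    gcongr
    refine (norm_add_le _ _).trans ?_
    rw [norm_neg]
    exact add_le_add hSb hTb
end

section
/- Let r₁,…,rₙ be distinct roots of the characteristic equation P(z)=0 with Re r_k ≠ 0 for all 1 ≤ k ≤ n. If y ∈ Cⁿ(ℝ,X) and y₁, y₂ ∈ Ker D are such that both y − y₁ and y − y₂ are bounded on ℝ, then y₁ = y₂. In particular, for each ε > 0 and each Ulam constant K, the element y_H ∈ Ker D with ‖y − y_H‖_∞ ≤ Kε is unique. -/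
open MeasureTheory

open Polynomial in
/-- Evaluation at `t` of `p(d/dt) w`, where only the coefficients of `p` below degree `N` count. -/
noncomputable def derivEval {E : Type*} [NormedAddCommGroup E] [NormedSpace ℂ E]
    (N : ℕ) (w : ℝ → E) (t : ℝ) : ℂ[X] →ₗ[ℂ] E :=
  ∑ i ∈ Finset.range N, (lcoeff ℂ i).smulRight (iteratedDeriv i w t)

section

variable {E : Type*} [NormedAddCommGroup E] [NormedSpace ℂ E]

open Polynomial in
lemma derivEval_apply (N : ℕ) (w : ℝ → E) (t : ℝ) (p : ℂ[X]) :
    derivEval N w t p = ∑ i ∈ Finset.range N, p.coeff i • iteratedDeriv i w t := by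
  simp [derivEval]

open Polynomial in
lemma derivEval_X_pow {N i : ℕ} (hi : i < N) (w : ℝ → E) (t : ℝ) :
    derivEval N w t (X ^ i : ℂ[X]) = iteratedDeriv i w t := by
  simp [derivEval_apply, coeff_X_pow, ite_smul, hi]

open Polynomial in
lemma hasDerivAt_derivEval {n : ℕ} {w : ℝ → E} (hw : ContDiff ℝ (n + 1) w) {p : ℂ[X]}
    (hp : p.degree < (n + 1 : ℕ)) (t : ℝ) :
    HasDerivAt (fun s => derivEval (n + 2) w s p) (derivEval (n + 2) w t (X * p)) t := by
  have h0 : p.coeff (n + 1) = 0 := coeff_eq_zero_of_degree_lt hp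
  simp only [derivEval_apply]
  rw [Finset.sum_range_succ' _ (n + 1)]
  simp only [Finset.sum_range_succ _ (n + 1), h0, coeff_X_mul, coeff_X_mul_zero, zero_smul,
    add_zero]
  refine HasDerivAt.fun_sum fun i hi => HasDerivAt.const_smul _ ?_
  rw [iteratedDeriv_succ]
  refine (hw.differentiable_iteratedDeriv i ?_ t).hasDerivAt
  exact_mod_cast Finset.mem_range.1 hi

lemma hasDerivAt_cexp_mul_ofReal (c : ℂ) (t : ℝ) :
    HasDerivAt (fun s : ℝ => Complex.exp (c * s)) (c * Complex.exp (c * t)) t := by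
  have h : HasDerivAt (fun s : ℝ => c * (s : ℂ)) c t := by
    simpa using (Complex.ofRealCLM.hasDerivAt (x := t)).const_mul c
  simpa [mul_comm] using h.cexp

/-- Solutions of `f' = c f` are exponentials. -/
lemma eq_cexp_smul_of_hasDerivAt {f : ℝ → E} {c : ℂ} (hf : ∀ t, HasDerivAt f (c • f t) t) (t : ℝ) :
    f t = Complex.exp (c * t) • f 0 := by
  have hg : ∀ s, HasDerivAt (fun s : ℝ => Complex.exp (-c * s) • f s) 0 s := fun s => by
    refine ((hasDerivAt_cexp_mul_ofReal (-c) s).smul (hf s)).congr_deriv ?_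
    rw [smul_smul, ← add_smul]
    ring_nf
    simp
  have h := is_const_of_deriv_eq_zero (fun s => (hg s).differentiableAt) (fun s => (hg s).deriv) t 0
  simp only [Complex.ofReal_zero, mul_zero, Complex.exp_zero, one_smul] at h
  rw [← h, smul_smul, ← Complex.exp_add]
  simp

lemma eq_zero_of_cexp_smul_bounded {c : ℂ} (hc : c.re ≠ 0) {x : E} {M : ℝ}
    (h : ∀ t : ℝ, ‖Complex.exp (c * t) • x‖ ≤ M) : x = 0 := by
  by_contra hx
  have hx' : 0 < ‖x‖ := norm_pos_iff.2 hx
  have h1 := h (M / ‖x‖ / c.re)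
  rw [norm_smul, Complex.norm_exp, Complex.re_mul_ofReal, mul_div_cancel₀ _ hc] at h1
  have h2 := Real.add_one_le_exp (M / ‖x‖)
  have h3 := (le_div_iff₀ hx').2 h1
  linarith

lemma exists_cexp_mul_ne {c d : ℂ} (h : c ≠ d) :
    ∃ s : ℝ, Complex.exp (c * s) ≠ Complex.exp (d * s) := by
  by_contra! H
  have h1 := hasDerivAt_cexp_mul_ofReal c 0
  rw [funext H] at h1
  exact h (by simpa using h1.unique (hasDerivAt_cexp_mul_ofReal d 0))

/-- A bounded combination of exponentials with distinct exponents off the imaginary axis has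
vanishing coefficients. -/
lemma eq_zero_of_sum_cexp_smul_bounded {ι : Type*} {r : ι → ℂ} (hinj : Function.Injective r)
    (hre : ∀ k, (r k).re ≠ 0) (S : Finset ι) (x : ι → E)
    (hb : ∃ M : ℝ, ∀ t : ℝ, ‖∑ k ∈ S, Complex.exp (r k * t) • x k‖ ≤ M) : ∀ k ∈ S, x k = 0 := by
  classical
  induction S using Finset.induction_on generalizing x with
  | empty => simp
  | insert m S hm ih =>
    obtain ⟨M, hM⟩ := hb
    have hS : ∀ k ∈ S, x k = 0 := by
      intro k hk
      obtain ⟨s, hs⟩ := exists_cexp_mul_ne (hinj.ne (ne_of_mem_of_not_mem hk hm))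
      have := ih (fun k => (Complex.exp (r k * s) - Complex.exp (r m * s)) • x k)
        ⟨M + ‖Complex.exp (r m * s)‖ * M, fun t => ?_⟩ k hk
      · exact (smul_eq_zero.1 this).resolve_left (sub_ne_zero.2 hs)
      · have key : ∑ k ∈ S, Complex.exp (r k * t) •
              (Complex.exp (r k * s) - Complex.exp (r m * s)) • x k =
            ∑ k ∈ insert m S, Complex.exp (r k * (t + s : ℝ)) • x k -
              Complex.exp (r m * s) • ∑ k ∈ insert m S, Complex.exp (r k * t) • x k := by
          rw [Finset.smul_sum, ← Finset.sum_sub_distrib, Finset.sum_insert hm]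
          have hzero : Complex.exp (r m * (t + s : ℝ)) • x m -
              Complex.exp (r m * s) • Complex.exp (r m * t) • x m = 0 := by
            rw [smul_smul, ← Complex.exp_add, Complex.ofReal_add, mul_add, add_comm (r m * t),
              sub_self]
          rw [hzero, zero_add]
          refine Finset.sum_congr rfl fun k _ => ?_
          rw [smul_smul, smul_smul, ← sub_smul, Complex.ofReal_add, mul_add, Complex.exp_add]
          ring_nf
        rw [key]
        refine (norm_sub_le _ _).trans (add_le_add (hM _) ?_)
        rw [norm_smul]
        exact mul_le_mul_of_nonneg_left (hM t) (norm_nonneg _)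
    have hmz : x m = 0 := by
      refine eq_zero_of_cexp_smul_bounded (hre m) (M := M) fun t => ?_
      have h := hM t
      rwa [Finset.sum_insert hm,
        Finset.sum_eq_zero fun k hk => by rw [hS k hk, smul_zero], add_zero] at h
    simpa [hmz] using hS

open Polynomial in
/-- A bounded solution of `D w = 0` vanishes when the characteristic roots are distinct and off the
imaginary axis. -/
lemma eq_zero_of_Dop_eq_zero_of_bounded {n : ℕ} {a r : Fin (n + 1) → ℂ}
    (hroot : ∀ k, r k ^ (n + 1) + ∑ j : Fin (n + 1), a j * r k ^ (n - (j : ℕ)) = 0)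
    (hinj : Function.Injective r) (hre : ∀ k, (r k).re ≠ 0) {w : ℝ → E}
    (hw : ContDiff ℝ (n + 1) w) (hker : Dop (n + 1) a w = 0)
    (hb : ∃ M : ℝ, ∀ t : ℝ, ‖w t‖ ≤ M) : w = 0 := by
  set R : ℂ[X] := ∑ j : Fin (n + 1), C (a j) * X ^ (n - (j : ℕ)) with hR
  have hRdeg : R.degree < (n + 1 : ℕ) := by
    refine (degree_sum_le _ _).trans_lt ((Finset.sup_lt_iff (WithBot.bot_lt_coe _)).2 fun j _ => ?_)
    exact (degree_C_mul_X_pow_le _ _).trans_lt (by exact_mod_cast (by omega))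
  have hP : ∀ t, derivEval (n + 2) w t (X ^ (n + 1) + R) = 0 := by
    intro t
    have h := congrFun hker t
    simp only [Dop, Pi.zero_apply, Nat.add_sub_cancel] at h
    rw [← h, map_add, derivEval_X_pow (by omega), hR, map_sum]
    congr 1
    refine Finset.sum_congr rfl fun j _ => ?_
    rw [C_mul', map_smul, derivEval_X_pow (by omega)]
  have hQ : ∀ Q : ℂ[X], Q.degree ≤ (n + 1 : ℕ) → (∀ k, Q.eval (r k) = 0) →
      ∀ t, derivEval (n + 2) w t Q = 0 := by
    intro Q hd he t
    have hz : Q - Q.coeff (n + 1) • (X ^ (n + 1) + R) = 0 := by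
      refine eq_zero_of_degree_lt_of_eval_index_eq_zero Finset.univ hinj.injOn ?_ ?_
      · rw [Finset.card_univ, Fintype.card_fin, degree_lt_iff_coeff_zero]
        intro m hm
        rw [coeff_sub, coeff_smul, coeff_add,
          coeff_eq_zero_of_degree_lt (hRdeg.trans_le (by exact_mod_cast hm)), coeff_X_pow]
        rcases hm.eq_or_lt with rfl | hlt
        · simp
        · rw [coeff_eq_zero_of_degree_lt (hd.trans_lt (by exact_mod_cast hlt))]
          simp [hlt.ne']
      · intro k _
        have hk : (X ^ (n + 1) + R).eval (r k) = 0 := by simpa [hR, eval_finsetSum] using hroot k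
        rw [eval_sub, he k, eval_smul, hk, smul_zero, sub_zero]
    rw [sub_eq_zero.1 hz, map_smul, hP, smul_zero]
  let b : Fin (n + 1) → ℂ[X] := Lagrange.basis Finset.univ r
  have hbdeg : ∀ k, (b k).degree < (n + 1 : ℕ) := fun k => by
    rw [Lagrange.degree_basis hinj.injOn (Finset.mem_univ k)]
    simp only [Finset.card_univ, Fintype.card_fin]
    exact_mod_cast (by omega)
  have hexp : ∀ k t, derivEval (n + 2) w t (b k) =
      Complex.exp (r k * t) • derivEval (n + 2) w 0 (b k) := by
    intro k t
    refine eq_cexp_smul_of_hasDerivAt (f := fun s => derivEval (n + 2) w s (b k)) (fun s => ?_) t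
    have h := hQ ((X - C (r k)) * b k) ?_ ?_ s
    · rw [sub_mul, map_sub, C_mul', map_smul, sub_eq_zero] at h
      rw [← h]
      exact hasDerivAt_derivEval hw (hbdeg k) s
    · rw [degree_mul, degree_X_sub_C, Lagrange.degree_basis hinj.injOn (Finset.mem_univ k)]
      simp only [Finset.card_univ, Fintype.card_fin]
      exact_mod_cast (by omega)
    · intro m
      rcases eq_or_ne k m with rfl | hkm
      · simp
      · rw [eval_mul, Lagrange.eval_basis_of_ne hkm (Finset.mem_univ m), mul_zero]
  have hsum : ∀ t, w t = ∑ k, Complex.exp (r k * t) • derivEval (n + 2) w 0 (b k) := by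
    intro t
    simp_rw [← hexp, ← map_sum]
    rw [Lagrange.sum_basis hinj.injOn Finset.univ_nonempty, ← pow_zero X,
      derivEval_X_pow (by omega), iteratedDeriv_zero]
  have hcoef := eq_zero_of_sum_cexp_smul_bounded hinj hre Finset.univ _
    (hb.imp fun M hM t => by rw [← hsum]; exact hM t)
  funext t
  rw [hsum]
  exact Finset.sum_eq_zero fun k hk => by rw [hcoef k hk, smul_zero]

lemma Dop_sub_s3 {n : ℕ} (a : Fin n → ℂ) {y₁ y₂ : ℝ → E} (h₁ : ContDiff ℝ n y₁)
    (h₂ : ContDiff ℝ n y₂) : Dop n a (y₁ - y₂) = Dop n a y₁ - Dop n a y₂ := by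
  have h : ∀ m ≤ n, ∀ t,
      iteratedDeriv m (y₁ - y₂) t = iteratedDeriv m y₁ t - iteratedDeriv m y₂ t := fun m hm t =>
    iteratedDeriv_sub (h₁.of_le (by exact_mod_cast hm)).contDiffAt
      (h₂.of_le (by exact_mod_cast hm)).contDiffAt
  funext t
  simp only [Dop, Pi.sub_apply]
  rw [h n le_rfl, Finset.sum_congr rfl fun (j : Fin n) _ => by rw [h _ (by omega), smul_sub],
    Finset.sum_sub_distrib]
  abel

end

theorem stmt3 {X : Type*} [NormedAddCommGroup X] [NormedSpace ℂ X] [CompleteSpace X]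
    (n : ℕ) (a : Fin (n + 1) → ℂ) (r : Fin (n + 1) → ℂ)
    (hroot : ∀ k, r k ^ (n + 1) + ∑ j : Fin (n + 1), a j * r k ^ (n - (j : ℕ)) = 0)
    (hinj : Function.Injective r)
    (hre : ∀ k, (r k).re ≠ 0)
    (y : ℝ → X) (hy : ContDiff ℝ (n + 1) y)
    (y₁ y₂ : ℝ → X)
    (hy₁ : ContDiff ℝ (n + 1) y₁) (hy₁ker : Dop (n + 1) a y₁ = 0)
    (hy₂ : ContDiff ℝ (n + 1) y₂) (hy₂ker : Dop (n + 1) a y₂ = 0)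
    (hb₁ : ∃ M : ℝ, ∀ t : ℝ, ‖y t - y₁ t‖ ≤ M)
    (hb₂ : ∃ M : ℝ, ∀ t : ℝ, ‖y t - y₂ t‖ ≤ M) :
    y₁ = y₂ := by
  have hker : Dop (n + 1) a (y₁ - y₂) = 0 := by
    rw [Dop_sub_s3 a (by exact_mod_cast hy₁) (by exact_mod_cast hy₂), hy₁ker, hy₂ker, sub_zero]
  obtain ⟨M₁, hM₁⟩ := hb₁
  obtain ⟨M₂, hM₂⟩ := hb₂
  refine sub_eq_zero.1 (eq_zero_of_Dop_eq_zero_of_bounded hroot hinj hre (hy₁.sub hy₂) hker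
    ⟨M₂ + M₁, fun t => ?_⟩)
  have h : (y₁ - y₂) t = (y t - y₂ t) - (y t - y₁ t) := by
    rw [Pi.sub_apply]
    abel
  rw [h]
  exact (norm_sub_le _ _).trans (add_le_add (hM₂ t) (hM₁ t))
end

section
/- Let r₁,…,rₙ ∈ ℂ be distinct with Re r_k ≠ 0 for all 1 ≤ k ≤ n, and let C₁,…,Cₙ ∈ X. If the function x ↦ Σ_{k=1}^n C_k e^{r_k x} is bounded on ℝ, then C₁ = C₂ = ⋯ = Cₙ = 0. -/
theorem eq_of_forall_exp_mul_ofReal_eq {a b : ℂ}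
    (h : ∀ x : ℝ, Complex.exp (a * x) = Complex.exp (b * x)) : a = b := by
  have hd (c : ℂ) : HasDerivAt (fun x : ℝ => Complex.exp (c * x)) c 0 := by
    simpa using ((hasDerivAt_id (0 : ℝ)).ofReal_comp.const_mul c).cexp
  have ha := hd a
  rw [funext h] at ha
  exact ha.unique (hd b)

theorem eq_zero_of_norm_exp_smul_le {X : Type*} [NormedAddCommGroup X] [NormedSpace ℂ X]
    {r : ℂ} (hr : r.re ≠ 0) {c : X} {M : ℝ}
    (hM : ∀ x : ℝ, ‖Complex.exp (r * x) • c‖ ≤ M) : c = 0 := by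
  by_contra hc
  have hc' : 0 < ‖c‖ := norm_pos_iff.mpr hc
  have h := hM (M / ‖c‖ / r.re)
  rw [norm_smul, Complex.norm_exp, Complex.re_mul_ofReal, mul_div_cancel₀ _ hr,
    ← le_div_iff₀ hc'] at h
  linarith [Real.add_one_le_exp (M / ‖c‖)]

/-- The induction step uses that `f (x + h) - exp (r a * h) • f x` is a bounded exponential sum
without the frequency `r a`. -/
theorem eq_zero_of_norm_sum_exp_smul_le {ι X : Type*} [NormedAddCommGroup X] [NormedSpace ℂ X]
    {r : ι → ℂ} (hinj : Function.Injective r) (hre : ∀ k, (r k).re ≠ 0) (s : Finset ι)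
    (C : ι → X) {M : ℝ} (hM : ∀ x : ℝ, ‖∑ k ∈ s, Complex.exp (r k * x) • C k‖ ≤ M) :
    ∀ k ∈ s, C k = 0 := by
  classical
  induction s using Finset.induction_on generalizing C M with
  | empty => simp
  | insert a s ha ih =>
    have hs : ∀ k ∈ s, C k = 0 := by
      intro k hk
      by_contra hC
      refine ha ((hinj (eq_of_forall_exp_mul_ofReal_eq fun h => ?_) : k = a) ▸ hk)
      have hshift := ih (fun j => (Complex.exp (r j * h) - Complex.exp (r a * h)) • C j)
        (M := M + ‖Complex.exp (r a * h)‖ * M) (fun x => ?_) k hk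
      · exact sub_eq_zero.mp ((smul_eq_zero.mp hshift).resolve_right hC)
      · have key : ∑ j ∈ s, Complex.exp (r j * x) •
              (Complex.exp (r j * h) - Complex.exp (r a * h)) • C j =
            ∑ j ∈ insert a s, Complex.exp (r j * (x + h : ℝ)) • C j -
              Complex.exp (r a * h) • ∑ j ∈ insert a s, Complex.exp (r j * x) • C j := by
          rw [Finset.smul_sum, ← Finset.sum_sub_distrib, Finset.sum_insert ha]
          simp only [smul_smul, ← sub_smul, Complex.ofReal_add, mul_add, Complex.exp_add]
          rw [mul_comm (Complex.exp (r a * h)), sub_self, zero_smul, zero_add]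
          exact Finset.sum_congr rfl fun j _ => by congr 1; ring
        rw [key]
        refine (norm_sub_le _ _).trans (add_le_add (hM _) ?_)
        rw [norm_smul]
        exact mul_le_mul_of_nonneg_left (hM x) (norm_nonneg _)
    rw [Finset.forall_mem_insert]
    refine ⟨eq_zero_of_norm_exp_smul_le (hre a) (M := M) fun x => ?_, hs⟩
    have h := hM x
    rwa [Finset.sum_insert ha, Finset.sum_eq_zero fun k hk => by rw [hs k hk, smul_zero],
      add_zero] at h

theorem stmt4 {X : Type*} [NormedAddCommGroup X] [NormedSpace ℂ X] [CompleteSpace X]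
    (n : ℕ) (r : Fin n → ℂ) (hinj : Function.Injective r)
    (hre : ∀ k, (r k).re ≠ 0)
    (C : Fin n → X)
    (hb : ∃ M : ℝ, ∀ x : ℝ, ‖∑ k : Fin n, Complex.exp (r k * x) • C k‖ ≤ M) :
    ∀ k, C k = 0 := by
  obtain ⟨M, hM⟩ := hb
  exact fun k => eq_zero_of_norm_sum_exp_smul_le hinj hre Finset.univ C hM k (Finset.mem_univ k)
end

section
/- Let r₁,…,rₙ be distinct roots of the characteristic equation P(z)=0 with Re r_k > 0 for 1 ≤ k ≤ p and Re r_k < 0 for p+1 ≤ k ≤ n (where 1 ≤ p ≤ n−1), and let K_D = (1/|V|)∫₀^∞ ( |Σ_{k=1}^p (−1)^k V_k e^{−r_k x}| + |Σ_{k=p+1}^n (−1)^k V_k e^{r_k x}| ) dx. Then every Ulam constant K of D satisfies K ≥ K_D; consequently K_D is the best (smallest) Ulam constant of D. -/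
open MeasureTheory

/-- `K` is an Ulam constant of the operator `D` determined by the coefficients `a`. -/
def IsUlamConstant {X : Type*} [NormedAddCommGroup X] [NormedSpace ℂ X]
    (n : ℕ) (a : Fin n → ℂ) (K : ℝ) : Prop :=
  0 ≤ K ∧ ∀ ε : ℝ, 0 < ε → ∀ y : ℝ → X, ContDiff ℝ n y →
    (∀ t : ℝ, ‖Dop n a y t‖ ≤ ε) →
    ∃ z : ℝ → X, ContDiff ℝ n z ∧ Dop n a z = 0 ∧ ∀ t : ℝ, ‖y t - z t‖ ≤ K * ε

open Polynomial Filter Topology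

theorem det_vandermonde_eq_mul_vandDel {n : ℕ} (r : Fin (n + 1) → ℂ) (k : Fin (n + 1)) :
    (-1 : ℂ) ^ (k : ℕ) * (Matrix.vandermonde r).det =
      (∏ j, (r (k.succAbove j) - r k)) * VandDel r k := by
  have h := Matrix.det_permute k.cycleRange.symm (Matrix.vandermonde r)
  have hs : ((Matrix.vandermonde r).submatrix k.cycleRange.symm id) =
      Matrix.vandermonde (fun i => r (k.cycleRange.symm i)) := rfl
  rw [hs, Matrix.det_vandermonde, Fin.prod_univ_succ] at h
  simp only [Fin.prod_Ioi_zero, Fin.prod_Ioi_succ, Fin.cycleRange_symm_succ,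
    Fin.cycleRange_symm_zero, Equiv.Perm.sign_symm, Fin.sign_cycleRange] at h
  rw [VandDel, Matrix.det_vandermonde (fun i : Fin n => r (k.succAbove i)), h]
  simp

theorem nodalWeight_univ_eq_prod_succAbove {n : ℕ} (r : Fin (n + 1) → ℂ) (k : Fin (n + 1)) :
    Lagrange.nodalWeight Finset.univ r k = ∏ j, (r k - r (k.succAbove j))⁻¹ := by
  rw [Lagrange.nodalWeight, Fin.univ_succAbove n k, Finset.erase_cons, Finset.prod_map]
  rfl

theorem neg_one_pow_mul_vandDel {n : ℕ} {r : Fin (n + 1) → ℂ} (hinj : Function.Injective r)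
    (k : Fin (n + 1)) :
    (-1 : ℂ) ^ ((k : ℕ) + 1) * VandDel r k =
      (-1 : ℂ) ^ (n + 1) * (Matrix.vandermonde r).det *
        Lagrange.nodalWeight Finset.univ r k := by
  have h := det_vandermonde_eq_mul_vandDel r k
  have hne : ∏ j, (r k - r (k.succAbove j)) ≠ 0 :=
    Finset.prod_ne_zero_iff.2 fun j _ =>
      sub_ne_zero.2 fun e => Fin.succAbove_ne k j (hinj e).symm
  have hp : ∏ j, (r (k.succAbove j) - r k) = (-1) ^ n * ∏ j, (r k - r (k.succAbove j)) := by
    rw [← Finset.prod_congr rfl fun j _ => neg_sub (r k) (r (k.succAbove j)), Finset.prod_neg]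
    simp
  have h1 : ((-1 : ℂ) ^ n) * (-1) ^ n = 1 := by rw [← mul_pow]; simp
  have h2 : ((-1 : ℂ) ^ (k : ℕ)) * (-1) ^ (k : ℕ) = 1 := by rw [← mul_pow]; simp
  rw [nodalWeight_univ_eq_prod_succAbove, Finset.prod_inv_distrib, ← div_eq_mul_inv,
    eq_div_iff hne]
  rw [hp] at h
  linear_combination (-1 : ℂ) ^ n * (-1) ^ (k : ℕ) * h -
    (-1 : ℂ) ^ (k : ℕ) * VandDel r k * (∏ j, (r k - r (k.succAbove j))) * h1 * (-1) -
    (-1 : ℂ) ^ n * (Matrix.vandermonde r).det * h2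

theorem sum_nodalWeight_mul_pow {n : ℕ} {r : Fin (n + 1) → ℂ} (hinj : Function.Injective r)
    {m : ℕ} (hm : m ≤ n) :
    ∑ k, Lagrange.nodalWeight Finset.univ r k * r k ^ m = if m = n then 1 else 0 := by
  have h := Lagrange.coeff_eq_sum (s := Finset.univ) (v := r) hinj.injOn (P := X ^ m) (by
    simpa [degree_X_pow] using by exact_mod_cast Nat.lt_succ_of_le hm)
  simp only [Finset.card_univ, Fintype.card_fin, Nat.add_sub_cancel, coeff_X_pow, eval_pow,
    eval_X] at h
  simp only [eq_comm (a := m), h, Lagrange.nodalWeight, Finset.prod_inv_distrib, div_eq_inv_mul]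

/-- A polynomial with constant coefficients evaluated at the differentiation operator, acting on
`y`, with terms of order above `N` discarded. -/
noncomputable def diffPoly {X : Type*} [NormedAddCommGroup X] [NormedSpace ℂ X]
    (N : ℕ) (y : ℝ → X) (t : ℝ) : ℂ[X] →ₗ[ℂ] X where
  toFun Q := ∑ m ∈ Finset.range (N + 1), Q.coeff m • iteratedDeriv m y t
  map_add' P Q := by simp [add_smul, Finset.sum_add_distrib]
  map_smul' c Q := by simp [mul_smul, Finset.smul_sum]

/-- The characteristic polynomial of `Dop (n + 1) a`. -/
noncomputable def charPoly {n : ℕ} (a : Fin (n + 1) → ℂ) : ℂ[X] :=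
  X ^ (n + 1) + ∑ j : Fin (n + 1), C (a j) * X ^ (n - (j : ℕ))

section

variable {X : Type*} [NormedAddCommGroup X] [NormedSpace ℂ X]

theorem diffPoly_apply (N : ℕ) (y : ℝ → X) (t : ℝ) (Q : ℂ[X]) :
    diffPoly N y t Q = ∑ m ∈ Finset.range (N + 1), Q.coeff m • iteratedDeriv m y t := rfl

theorem diffPoly_X_pow {N m : ℕ} (hm : m ≤ N) (y : ℝ → X) (t : ℝ) :
    diffPoly N y t (Polynomial.X ^ m) = iteratedDeriv m y t := by
  simp [diffPoly_apply, coeff_X_pow, Nat.lt_succ_of_le hm]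

theorem diffPoly_charPoly {n : ℕ} (a : Fin (n + 1) → ℂ) (y : ℝ → X) (t : ℝ) :
    diffPoly (n + 1) y t (charPoly a) = Dop (n + 1) a y t := by
  simp only [charPoly, map_add, map_sum, ← smul_eq_C_mul, map_smul, Dop, Nat.add_sub_cancel]
  rw [diffPoly_X_pow le_rfl]
  congr 1
  refine Finset.sum_congr rfl fun j _ => ?_
  rw [diffPoly_X_pow (by omega)]

theorem hasDerivAt_diffPoly {N : ℕ} {y : ℝ → X} (hy : ContDiff ℝ N y) {Q : ℂ[X]}
    (hQ : Q.natDegree < N) (t : ℝ) :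
    HasDerivAt (fun t => diffPoly N y t Q) (diffPoly N y t (Polynomial.X * Q)) t := by
  have h1 : ∀ s, diffPoly N y s Q = ∑ m ∈ Finset.range N, Q.coeff m • iteratedDeriv m y s := by
    intro s
    rw [diffPoly_apply, Finset.sum_range_succ, coeff_eq_zero_of_natDegree_lt hQ]
    simp
  simp only [h1]
  rw [diffPoly_apply, Finset.sum_range_succ']
  simp only [coeff_X_mul, coeff_X_mul_zero, zero_smul, add_zero]
  refine HasDerivAt.fun_sum fun m hm => HasDerivAt.const_smul _ ?_
  rw [iteratedDeriv_succ]
  exact ((hy.differentiable_iteratedDeriv m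
    (by exact_mod_cast Finset.mem_range.1 hm)) t).hasDerivAt

theorem charPoly_eq_nodal {n : ℕ} {a : Fin (n + 1) → ℂ} {r : Fin (n + 1) → ℂ}
    (hroot : ∀ k, r k ^ (n + 1) + ∑ j : Fin (n + 1), a j * r k ^ (n - (j : ℕ)) = 0)
    (hinj : Function.Injective r) : charPoly a = Lagrange.nodal Finset.univ r := by
  have hlow : (∑ j : Fin (n + 1), C (a j) * Polynomial.X ^ (n - (j : ℕ))).degree <
      ((n + 1 : ℕ) : WithBot ℕ) := by
    refine (degree_sum_le _ _).trans_lt ((Finset.sup_lt_iff (WithBot.bot_lt_coe _)).2 ?_)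
    intro j _
    exact (degree_C_mul_X_pow_le _ _).trans_lt (by exact_mod_cast (by omega))
  have hmonic : (charPoly a).Monic := monic_X_pow_add hlow
  have hdeg : (charPoly a).degree = ((n + 1 : ℕ) : WithBot ℕ) := by
    rw [charPoly, degree_add_eq_left_of_degree_lt (by rwa [degree_X_pow]), degree_X_pow]
  refine Polynomial.eq_of_degree_le_of_eval_index_eq (v := r) Finset.univ hinj.injOn ?_ ?_ ?_ ?_
  · simp [hdeg]
  · rw [hdeg, Lagrange.degree_nodal]; simp
  · rw [hmonic.leadingCoeff, Lagrange.nodal_monic.leadingCoeff]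
  · intro k _
    rw [Lagrange.eval_nodal_at_node (Finset.mem_univ k), ← hroot k]
    simp [charPoly, eval_finsetSum]

theorem eq_exp_smul_of_hasDerivAt {u : ℝ → X} {c : ℂ} (hu : ∀ t, HasDerivAt u (c • u t) t)
    (t : ℝ) : u t = Complex.exp (c * t) • u 0 := by
  have he : ∀ s : ℝ, HasDerivAt (fun s : ℝ => Complex.exp (-c * s))
      (Complex.exp (-c * s) * (-c)) s := fun s => by
    have h : HasDerivAt (fun s : ℝ => -c * (s : ℂ)) (-c) s := by
      simpa using (Complex.ofRealCLM.hasDerivAt (x := s)).const_mul (-c)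
    exact h.cexp
  have hd : ∀ s : ℝ, HasDerivAt (fun s : ℝ => Complex.exp (-c * s) • u s) 0 s := fun s => by
    refine ((he s).smul (hu s)).congr_deriv ?_
    module
  have h := is_const_of_deriv_eq_zero (fun s => (hd s).differentiableAt)
    (fun s => (hd s).deriv) t 0
  simp only [Complex.ofReal_zero, mul_zero, Complex.exp_zero, one_smul] at h
  rw [← h, smul_smul, ← Complex.exp_add]
  simp

/-- Every solution of the homogeneous equation is a sum of exponentials. -/
theorem exists_eq_sum_exp_smul {n : ℕ} {a : Fin (n + 1) → ℂ} {r : Fin (n + 1) → ℂ}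
    (hroot : ∀ k, r k ^ (n + 1) + ∑ j : Fin (n + 1), a j * r k ^ (n - (j : ℕ)) = 0)
    (hinj : Function.Injective r) {z : ℝ → X} (hz : ContDiff ℝ (n + 1 : ℕ) z)
    (hD : Dop (n + 1) a z = 0) :
    ∃ v : Fin (n + 1) → X, ∀ t : ℝ, z t = ∑ k, Complex.exp (r k * t) • v k := by
  set b : Fin (n + 1) → ℂ[X] := fun k => Lagrange.basis Finset.univ r k
  have hb : ∀ k, (b k).natDegree < n + 1 := fun k => by
    rw [Lagrange.natDegree_basis hinj.injOn (Finset.mem_univ k)]; simp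
  have hmul : ∀ k, Polynomial.X * b k =
      r k • b k + Lagrange.nodalWeight Finset.univ r k • charPoly a := fun k => by
    have h1 : (Polynomial.X - C (r k)) * b k =
        C (Lagrange.nodalWeight Finset.univ r k) * charPoly a := by
      rw [charPoly_eq_nodal hroot hinj]
      simp only [b, Lagrange.basis_eq_prod_sub_inv_mul_nodal_div (Finset.mem_univ k)]
      rw [mul_left_comm, EuclideanDomain.mul_div_cancel' (X_sub_C_ne_zero _)
        (Lagrange.X_sub_C_dvd_nodal r (Finset.mem_univ k))]
    rw [smul_eq_C_mul, smul_eq_C_mul, ← h1]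
    ring
  have hu : ∀ k t, HasDerivAt (fun t => diffPoly (n + 1) z t (b k))
      (r k • diffPoly (n + 1) z t (b k)) t := fun k t => by
    refine (hasDerivAt_diffPoly hz (hb k) t).congr_deriv ?_
    rw [hmul, map_add, map_smul, map_smul, diffPoly_charPoly, hD]
    simp
  refine ⟨fun k => diffPoly (n + 1) z 0 (b k), fun t => ?_⟩
  have h1 : diffPoly (n + 1) z t 1 = z t := by
    simpa using diffPoly_X_pow (Nat.zero_le (n + 1)) z t
  rw [← h1, ← Lagrange.sum_basis hinj.injOn Finset.univ_nonempty, map_sum]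
  exact Finset.sum_congr rfl fun k _ => eq_exp_smul_of_hasDerivAt (hu k) t

theorem eq_zero_of_bounded_exp_smul {c : ℂ} (hc : c.re ≠ 0) {v : X} {M : ℝ}
    (h : ∀ t : ℝ, ‖Complex.exp (c * t) • v‖ ≤ M) : v = 0 := by
  by_contra hv
  have hv' : 0 < ‖v‖ := norm_pos_iff.2 hv
  have hM := h ((M / ‖v‖) / c.re)
  rw [norm_smul, Complex.norm_exp, Complex.re_mul_ofReal, mul_div_cancel₀ _ hc] at hM
  have := Real.add_one_le_exp (M / ‖v‖)
  have h2 : (M / ‖v‖ + 1) * ‖v‖ ≤ M := (mul_le_mul_of_nonneg_right this hv'.le).trans hM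
  rw [add_mul, div_mul_cancel₀ _ hv'.ne'] at h2
  linarith

theorem exists_exp_mul_ofReal_ne {c d : ℂ} (hcd : c ≠ d) :
    ∃ h : ℝ, Complex.exp (c * h) - Complex.exp (d * h) ≠ 0 := by
  by_contra! H
  have hd : ∀ e : ℂ, HasDerivAt (fun s : ℝ => Complex.exp (e * s)) e 0 := fun e => by
    have h : HasDerivAt (fun s : ℝ => e * (s : ℂ)) e 0 := by
      simpa using (Complex.ofRealCLM.hasDerivAt (x := (0 : ℝ))).const_mul e
    simpa using h.cexp
  refine hcd ((hd c).unique ?_)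
  rw [show (fun s : ℝ => Complex.exp (c * s)) = fun s : ℝ => Complex.exp (d * s) from
    funext fun s => sub_eq_zero.1 (H s)]
  exact hd d

/-- A bounded combination of exponentials with pairwise distinct exponents off the imaginary
axis has vanishing coefficients. -/
theorem eq_zero_of_bounded_sum_exp_smul {ι : Type*} {r : ι → ℂ} (hinj : Function.Injective r)
    (hre : ∀ k, (r k).re ≠ 0) (s : Finset ι) : ∀ (v : ι → X) (M : ℝ),
    (∀ t : ℝ, ‖∑ k ∈ s, Complex.exp (r k * t) • v k‖ ≤ M) → ∀ k ∈ s, v k = 0 := by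
  classical
  induction s using Finset.induction_on with
  | empty => simp
  | insert j s hj ih =>
    intro v M hM
    have hs : ∀ k ∈ s, v k = 0 := by
      intro k hk
      obtain ⟨h, hh⟩ := exists_exp_mul_ofReal_ne (hinj.ne (fun e => hj (e ▸ hk)) : r k ≠ r j)
      have key := ih (fun k => (Complex.exp (r k * h) - Complex.exp (r j * h)) • v k)
        (M + ‖Complex.exp (r j * h)‖ * M) (fun t => ?_) k hk
      · exact (smul_eq_zero.1 key).resolve_left hh
      · have e : ∑ k ∈ s, Complex.exp (r k * t) •
            (Complex.exp (r k * h) - Complex.exp (r j * h)) • v k =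
            ∑ k ∈ insert j s, Complex.exp (r k * (t + h : ℝ)) • v k -
              Complex.exp (r j * h) • ∑ k ∈ insert j s, Complex.exp (r k * t) • v k := by
          rw [Finset.smul_sum, ← Finset.sum_sub_distrib, Finset.sum_insert hj]
          have : ∀ k, Complex.exp (r k * (t + h : ℝ)) • v k -
              Complex.exp (r j * h) • Complex.exp (r k * t) • v k =
              Complex.exp (r k * t) • (Complex.exp (r k * h) - Complex.exp (r j * h)) • v k := by
            intro k
            rw [Complex.ofReal_add, mul_add, Complex.exp_add]
            module
          simp only [this, sub_self, zero_smul, smul_zero, zero_add]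
        rw [e]
        refine (norm_sub_le _ _).trans (add_le_add (hM _) ?_)
        rw [norm_smul]
        exact mul_le_mul_of_nonneg_left (hM t) (norm_nonneg _)
    have hjz : v j = 0 := by
      refine eq_zero_of_bounded_exp_smul (hre j) (M := M) fun t => ?_
      have := hM t
      rwa [Finset.sum_insert hj, Finset.sum_eq_zero fun k hk => by rw [hs k hk, smul_zero],
        add_zero] at this
    intro k hk
    rcases Finset.mem_insert.1 hk with rfl | hk
    · exact hjz
    · exact hs k hk

theorem eq_zero_of_bounded_of_Dop_eq_zero {n : ℕ} {a : Fin (n + 1) → ℂ} {r : Fin (n + 1) → ℂ}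
    (hroot : ∀ k, r k ^ (n + 1) + ∑ j : Fin (n + 1), a j * r k ^ (n - (j : ℕ)) = 0)
    (hinj : Function.Injective r) (hre : ∀ k, (r k).re ≠ 0) {z : ℝ → X}
    (hz : ContDiff ℝ (n + 1 : ℕ) z) (hD : Dop (n + 1) a z = 0) {M : ℝ}
    (hM : ∀ t, ‖z t‖ ≤ M) (t : ℝ) : z t = 0 := by
  obtain ⟨v, hv⟩ := exists_eq_sum_exp_smul hroot hinj hz hD
  have h0 := eq_zero_of_bounded_sum_exp_smul hinj hre Finset.univ v M fun t => hv t ▸ hM t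
  rw [hv t]
  exact Finset.sum_eq_zero fun k hk => by rw [h0 k hk, smul_zero]

/-- Variation of constants: solutions of the first-order equations `w k' = r k • w k + f` combine
to a solution of the equation of order `n + 1` with right-hand side `f`. -/
theorem iteratedDeriv_sum_nodalWeight_smul {n : ℕ} {r : Fin (n + 1) → ℂ}
    (hinj : Function.Injective r) {f : ℝ → X} {w : Fin (n + 1) → ℝ → X}
    (hw : ∀ k t, HasDerivAt (w k) (r k • w k t + f t) t) {m : ℕ} (hm : m ≤ n) :
    iteratedDeriv m (fun t => ∑ k, Lagrange.nodalWeight Finset.univ r k • w k t) =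
      fun t => ∑ k, (Lagrange.nodalWeight Finset.univ r k * r k ^ m) • w k t := by
  induction m with
  | zero => simp
  | succ m ih =>
    rw [iteratedDeriv_succ, ih (by omega)]
    funext t
    refine (HasDerivAt.fun_sum fun k _ => (hw k t).const_smul
      (Lagrange.nodalWeight Finset.univ r k * r k ^ m)).deriv.trans ?_
    have := sum_nodalWeight_mul_pow hinj (show m ≤ n by omega)
    rw [if_neg (by omega)] at this
    simp only [smul_add, Finset.sum_add_distrib, ← Finset.sum_smul, this, zero_smul, add_zero,
      smul_smul, pow_succ, mul_assoc]

theorem contDiff_and_Dop_sum_nodalWeight_smul {n : ℕ} {a : Fin (n + 1) → ℂ}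
    {r : Fin (n + 1) → ℂ}
    (hroot : ∀ k, r k ^ (n + 1) + ∑ j : Fin (n + 1), a j * r k ^ (n - (j : ℕ)) = 0)
    (hinj : Function.Injective r) {f : ℝ → X} (hf : Continuous f) {w : Fin (n + 1) → ℝ → X}
    (hw : ∀ k t, HasDerivAt (w k) (r k • w k t + f t) t) :
    ContDiff ℝ (n + 1 : ℕ) (fun t => ∑ k, Lagrange.nodalWeight Finset.univ r k • w k t) ∧
      Dop (n + 1) a (fun t => ∑ k, Lagrange.nodalWeight Finset.univ r k • w k t) = f := by
  set c := Lagrange.nodalWeight Finset.univ r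
  have hlow : ∀ m ≤ n, iteratedDeriv m (fun t => ∑ k, c k • w k t) =
      fun t => ∑ k, (c k * r k ^ m) • w k t :=
    fun m hm => iteratedDeriv_sum_nodalWeight_smul hinj hw hm
  have hderiv : ∀ m t, HasDerivAt (fun t => ∑ k, (c k * r k ^ m) • w k t)
      (∑ k, (c k * r k ^ m) • (r k • w k t + f t)) t := fun m t =>
    HasDerivAt.fun_sum fun k _ => (hw k t).const_smul _
  have htop : iteratedDeriv (n + 1) (fun t => ∑ k, c k • w k t) =
      fun t => ∑ k, (c k * r k ^ (n + 1)) • w k t + f t := by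
    rw [iteratedDeriv_succ, hlow n le_rfl]
    funext t
    rw [(hderiv n t).deriv]
    have := sum_nodalWeight_mul_pow hinj (le_refl n)
    rw [if_pos rfl] at this
    simp only [smul_add, Finset.sum_add_distrib, ← Finset.sum_smul, c, this, one_smul,
      smul_smul, pow_succ, mul_assoc]
  have hwc : ∀ k, Continuous (w k) := fun k =>
    continuous_iff_continuousAt.2 fun t => (hw k t).continuousAt
  refine ⟨contDiff_nat_iff_iteratedDeriv.2 ⟨fun m hm => ?_, fun m hm => ?_⟩, ?_⟩
  · rcases Nat.lt_or_ge n m with h | h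
    · obtain rfl : m = n + 1 := by omega
      rw [htop]
      fun_prop
    · rw [hlow m h]
      fun_prop
  · rw [hlow m (by omega)]
    exact fun t => (hderiv m t).differentiableAt
  · funext t
    have h0 : ∑ k, (c k * (r k ^ (n + 1) +
        ∑ j : Fin (n + 1), a j * r k ^ (n - (j : ℕ)))) • w k t = 0 :=
      Finset.sum_eq_zero fun k _ => by rw [hroot k, mul_zero, zero_smul]
    simp only [mul_add, add_smul, Finset.sum_add_distrib, Finset.mul_sum, Finset.sum_smul] at h0
    rw [Finset.sum_comm] at h0
    rw [Dop, htop]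
    have h1 : ∑ j : Fin (n + 1), a j • iteratedDeriv (n + 1 - 1 - (j : ℕ))
        (fun t => ∑ k, c k • w k t) t =
        ∑ j : Fin (n + 1), ∑ k, (c k * (a j * r k ^ (n - (j : ℕ)))) • w k t := by
      refine Finset.sum_congr rfl fun j _ => ?_
      rw [Nat.add_sub_cancel, hlow _ (Nat.sub_le _ _), Finset.smul_sum]
      refine Finset.sum_congr rfl fun k _ => ?_
      rw [smul_smul, mul_left_comm]
    rw [h1, add_right_comm, h0, zero_add]

theorem integrableOn_exp_smul {c : ℂ} (hc : 0 < c.re) {f : ℝ → X} (hf : Continuous f) {M : ℝ}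
    (hM : ∀ t, ‖f t‖ ≤ M) (b : ℝ) :
    IntegrableOn (fun x : ℝ => Complex.exp (-c * x) • f x) (Set.Ioi b) := by
  have h := (integrableOn_exp_mul_complex_Ioi (a := -c) (by simpa using hc) b).norm.mul_const M
  refine Integrable.mono' h (by fun_prop) (Eventually.of_forall fun x => ?_)
  rw [norm_smul]
  exact mul_le_mul_of_nonneg_left (hM x) (norm_nonneg _)

theorem hasDerivAt_integral_exp_smul_add [CompleteSpace X] {c : ℂ} (hc : 0 < c.re) {f : ℝ → X}
    (hf : Continuous f) {M : ℝ} (hM : ∀ t, ‖f t‖ ≤ M) (t : ℝ) :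
    HasDerivAt (fun t : ℝ => ∫ x in Set.Ioi (0 : ℝ), Complex.exp (-c * x) • f (t + x))
      (c • (∫ x in Set.Ioi (0 : ℝ), Complex.exp (-c * x) • f (t + x)) - f t) t := by
  set g : ℝ → X := fun x => Complex.exp (-c * x) • f x
  have hg : Continuous g := by fun_prop
  have hrep : ∀ t : ℝ, ∫ x in Set.Ioi (0 : ℝ), Complex.exp (-c * x) • f (t + x) =
      Complex.exp (c * t) • ((∫ x in Set.Ioi (0 : ℝ), g x) - ∫ x in (0 : ℝ)..t, g x) := by
    intro t
    rw [← intervalIntegral.integral_Ioi_sub_Ioi' (integrableOn_exp_smul hc hf hM 0)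
      (integrableOn_exp_smul hc hf hM t), sub_sub_cancel, ← integral_smul]
    have h := (measurePreserving_add_left volume t).setIntegral_preimage_emb
      (measurableEmbedding_addLeft t) (fun x => Complex.exp (c * t) • g x) (Set.Ioi t)
    rw [← h, Set.preimage_const_add_Ioi, sub_self]
    refine integral_congr_ae (Eventually.of_forall fun x => ?_)
    simp only [g]
    rw [smul_smul, ← Complex.exp_add]
    push_cast
    ring_nf
  have he : HasDerivAt (fun t : ℝ => Complex.exp (c * t)) (Complex.exp (c * t) * c) t := by
    have h : HasDerivAt (fun s : ℝ => c * (s : ℂ)) c t := by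
      simpa using (Complex.ofRealCLM.hasDerivAt (x := t)).const_mul c
    exact h.cexp
  have hi : HasDerivAt (fun t => ∫ x in (0 : ℝ)..t, g x) (g t) t :=
    intervalIntegral.integral_hasDerivAt_right (hg.intervalIntegrable _ _)
      (hg.stronglyMeasurableAtFilter _ _) hg.continuousAt
  simp only [hrep]
  refine (he.smul (hi.const_sub _)).congr_deriv ?_
  have h1 : Complex.exp (c * t) • g t = f t := by
    simp only [g]
    rw [smul_smul, ← Complex.exp_add]
    simp
  rw [smul_neg, h1, mul_comm, mul_smul]
  abel

theorem hasDerivAt_integral_exp_smul_sub [CompleteSpace X] {c : ℂ} (hc : c.re < 0) {f : ℝ → X}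
    (hf : Continuous f) {M : ℝ} (hM : ∀ t, ‖f t‖ ≤ M) (t : ℝ) :
    HasDerivAt (fun t : ℝ => ∫ x in Set.Ioi (0 : ℝ), Complex.exp (c * x) • f (t - x))
      (c • (∫ x in Set.Ioi (0 : ℝ), Complex.exp (c * x) • f (t - x)) + f t) t := by
  have h := (hasDerivAt_integral_exp_smul_add (c := -c) (by simpa using hc)
    (f := fun s => f (-s)) (by fun_prop) (fun s => hM (-s)) (-t)).scomp t (hasDerivAt_neg t)
  simp only [Function.comp_def, neg_neg, neg_add_rev, ← sub_eq_neg_add] at h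
  refine h.congr_deriv ?_
  simp only [neg_sub, neg_smul, one_smul]
  abel

theorem integrableOn_sum_exp {ι : Type*} (s : Finset ι) (c e : ι → ℂ)
    (he : ∀ k ∈ s, (e k).re < 0) :
    IntegrableOn (fun x : ℝ => ∑ k ∈ s, c k * Complex.exp (e k * x)) (Set.Ioi 0) :=
  integrable_finsetSum _ fun k hk =>
    (integrableOn_exp_mul_complex_Ioi (he k hk) 0).const_mul (c k)

/-- The bounded solution of `D y = f` is the convolution of `f` with the Green function, whose
restrictions to the positive and negative half-lines are the sums below. -/
theorem exists_Dop_eq_and_eq_integral [CompleteSpace X] {n : ℕ} {a : Fin (n + 1) → ℂ}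
    {r : Fin (n + 1) → ℂ}
    (hroot : ∀ k, r k ^ (n + 1) + ∑ j : Fin (n + 1), a j * r k ^ (n - (j : ℕ)) = 0)
    (hinj : Function.Injective r) {p : ℕ}
    (hpos : ∀ k : Fin (n + 1), (k : ℕ) < p → 0 < (r k).re)
    (hneg : ∀ k : Fin (n + 1), p ≤ (k : ℕ) → (r k).re < 0)
    {f : ℝ → X} (hf : Continuous f) {M : ℝ} (hM : ∀ t, ‖f t‖ ≤ M) :
    ∃ y : ℝ → X, ContDiff ℝ (n + 1 : ℕ) y ∧ Dop (n + 1) a y = f ∧ ∀ t, y t =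
      ∫ x in Set.Ioi (0 : ℝ),
        ((∑ k ∈ Finset.univ.filter (fun k : Fin (n + 1) => p ≤ (k : ℕ)),
          Lagrange.nodalWeight Finset.univ r k * Complex.exp (r k * x)) • f (t - x) -
        (∑ k ∈ Finset.univ.filter (fun k : Fin (n + 1) => (k : ℕ) < p),
          Lagrange.nodalWeight Finset.univ r k * Complex.exp (-(r k) * x)) • f (t + x)) := by
  set c := Lagrange.nodalWeight Finset.univ r
  set w : Fin (n + 1) → ℝ → X := fun k t => if (k : ℕ) < p
    then -∫ x in Set.Ioi (0 : ℝ), Complex.exp (-(r k) * x) • f (t + x)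
    else ∫ x in Set.Ioi (0 : ℝ), Complex.exp (r k * x) • f (t - x)
  have hw : ∀ k t, HasDerivAt (w k) (r k • w k t + f t) t := by
    intro k t
    by_cases hk : (k : ℕ) < p
    · simp only [w, hk, if_true]
      refine (hasDerivAt_integral_exp_smul_add (hpos k hk) hf hM t).neg.congr_deriv ?_
      module
    · simp only [w, hk, if_false]
      exact hasDerivAt_integral_exp_smul_sub (hneg k (not_lt.1 hk)) hf hM t
  obtain ⟨h1, h2⟩ := contDiff_and_Dop_sum_nodalWeight_smul hroot hinj hf hw
  refine ⟨_, h1, h2, fun t => ?_⟩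
  have hplus : ∀ k ∈ Finset.univ.filter (fun k : Fin (n + 1) => (k : ℕ) < p),
      IntegrableOn (fun x : ℝ => (c k * Complex.exp (-(r k) * x)) • f (t + x)) (Set.Ioi 0) := by
    intro k hk
    simp only [mul_smul]
    exact (integrableOn_exp_smul (hpos k (Finset.mem_filter.1 hk).2) (f := fun x => f (t + x))
      (by fun_prop) (fun x => hM _) 0).smul (c k)
  have hminus : ∀ k ∈ Finset.univ.filter (fun k : Fin (n + 1) => p ≤ (k : ℕ)),
      IntegrableOn (fun x : ℝ => (c k * Complex.exp (r k * x)) • f (t - x)) (Set.Ioi 0) := by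
    intro k hk
    have := (integrableOn_exp_smul (c := -r k) (by
      simpa using hneg k (Finset.mem_filter.1 hk).2) (f := fun x => f (t - x))
      (by fun_prop) (fun x => hM _) 0).smul (c k)
    simp only [neg_neg] at this
    simp only [mul_smul]
    exact this
  simp only [Finset.sum_smul]
  rw [integral_sub (integrable_finsetSum _ hminus) (integrable_finsetSum _ hplus),
    integral_finsetSum _ hminus, integral_finsetSum _ hplus,
    ← Finset.sum_filter_add_sum_filter_not Finset.univ (fun k : Fin (n + 1) => (k : ℕ) < p),
    add_comm, sub_eq_add_neg, ← Finset.sum_neg_distrib]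
  simp only [not_lt]
  congr 1 <;> refine Finset.sum_congr rfl fun k hk => ?_
  · have hk' := (Finset.mem_filter.1 hk).2
    simp only [w, hk'.not_gt, if_false, mul_smul, integral_smul]
    rfl
  · have hk' := (Finset.mem_filter.1 hk).2
    simp only [w, hk', if_true, mul_smul, integral_smul, smul_neg]
    rfl

end

/-- Duality between `L¹` and the continuous functions of modulus at most one, for a kernel given
by its two continuous halves. -/
theorem integral_norm_add_norm_le {A B : ℝ → ℂ} (hA : Continuous A) (hB : Continuous B)
    (hAi : IntegrableOn A (Set.Ioi 0)) (hBi : IntegrableOn B (Set.Ioi 0)) (h0 : A 0 + B 0 = 0)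
    {K : ℝ} (hK : ∀ φ : ℝ → ℂ, Continuous φ → (∀ t, ‖φ t‖ ≤ 1) →
      ‖∫ x in Set.Ioi (0 : ℝ), (B x * φ (-x) - A x * φ x)‖ ≤ K) :
    ∫ x in Set.Ioi (0 : ℝ), (‖A x‖ + ‖B x‖) ≤ K := by
  have hden : ∀ (m : ℕ) (z : ℂ), 0 < ‖z‖ + 1 / ((m : ℝ) + 1) := fun m z => by positivity
  have hlim : Tendsto (fun m : ℕ => ∫ x in Set.Ioi (0 : ℝ),
      (‖A x‖ ^ 2 / (‖A x‖ + 1 / ((m : ℝ) + 1)) + ‖B x‖ ^ 2 / (‖B x‖ + 1 / ((m : ℝ) + 1))))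
      atTop (𝓝 (∫ x in Set.Ioi (0 : ℝ), (‖A x‖ + ‖B x‖))) := by
    refine tendsto_integral_of_dominated_convergence (fun x => ‖A x‖ + ‖B x‖) (fun m => ?_)
      (hAi.norm.add hBi.norm) (fun m => Eventually.of_forall fun x => ?_)
      (Eventually.of_forall fun x => ?_)
    · exact (((hA.norm.pow 2).div (by fun_prop) fun x => (hden m (A x)).ne').add
        ((hB.norm.pow 2).div (by fun_prop) fun x => (hden m (B x)).ne')).aestronglyMeasurable
    · have hle : ∀ z : ℂ, ‖z‖ ^ 2 / (‖z‖ + 1 / ((m : ℝ) + 1)) ≤ ‖z‖ := fun z => by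
        rw [div_le_iff₀ (hden m z), sq]
        exact mul_le_mul_of_nonneg_left (le_add_of_nonneg_right (by positivity)) (norm_nonneg _)
      rw [Real.norm_of_nonneg (by positivity)]
      exact add_le_add (hle _) (hle _)
    · have ht : ∀ z : ℂ, Tendsto (fun m : ℕ => ‖z‖ ^ 2 / (‖z‖ + 1 / ((m : ℝ) + 1))) atTop
          (𝓝 ‖z‖) := fun z => by
        rcases eq_or_ne z 0 with rfl | hz
        · simp
        · have hz' : ‖z‖ ≠ 0 := norm_ne_zero_iff.2 hz
          have := (tendsto_const_nhds (x := ‖z‖ ^ 2)).div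
            (tendsto_one_div_add_atTop_nhds_zero_nat.const_add ‖z‖) (by simpa using hz')
          rwa [add_zero, sq, mul_div_cancel_right₀ _ hz', ← sq] at this
      exact (ht _).add (ht _)
  refine le_of_tendsto hlim (Eventually.of_forall fun m => ?_)
  set g : ℝ → ℂ := fun s => if 0 ≤ s then -A s else B (-s)
  have hg : Continuous g := Continuous.if_le (by fun_prop) (by fun_prop) continuous_const
    continuous_id (fun s hs => by
      subst hs; rw [neg_zero]; exact neg_eq_of_add_eq_zero_right h0)
  set φ : ℝ → ℂ := fun s => star (g s) / ((‖g s‖ + 1 / ((m : ℝ) + 1) : ℝ) : ℂ)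
  have hφ : Continuous φ := (continuous_star.comp hg).div
    (Complex.continuous_ofReal.comp (by fun_prop))
    fun s => Complex.ofReal_ne_zero.2 (hden m (g s)).ne'
  have hφ1 : ∀ t, ‖φ t‖ ≤ 1 := fun t => by
    simp only [φ]
    rw [norm_div, norm_star, Complex.norm_of_nonneg (hden m (g t)).le, div_le_one (hden m (g t))]
    exact le_add_of_nonneg_right (by positivity)
  have hmul : ∀ z : ℂ, z * (star z / ((‖z‖ + 1 / ((m : ℝ) + 1) : ℝ) : ℂ)) =
      ((‖z‖ ^ 2 / (‖z‖ + 1 / ((m : ℝ) + 1)) : ℝ) : ℂ) := fun z => by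
    rw [← mul_div_assoc]
    have : z * star z = ((‖z‖ ^ 2 : ℝ) : ℂ) := by
      simpa using Complex.mul_conj' z
    rw [this, ← Complex.ofReal_div]
  have hint := hK φ hφ hφ1
  have heq : ∫ x in Set.Ioi (0 : ℝ), (B x * φ (-x) - A x * φ x) =
      ((∫ x in Set.Ioi (0 : ℝ), (‖A x‖ ^ 2 / (‖A x‖ + 1 / ((m : ℝ) + 1)) +
        ‖B x‖ ^ 2 / (‖B x‖ + 1 / ((m : ℝ) + 1))) : ℝ) : ℂ) := by
    rw [← integral_complex_ofReal]
    refine setIntegral_congr_fun measurableSet_Ioi fun x hx => ?_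
    have hx' : (0 : ℝ) < x := hx
    have hgx : g x = -A x := if_pos hx'.le
    have hgx' : g (-x) = B x := by
      simp only [g, neg_neg]
      exact if_neg (by linarith)
    have e1 := hmul (-A x)
    rw [norm_neg, neg_mul] at e1
    simp only [φ, hgx, hgx', norm_neg]
    rw [hmul (B x), sub_eq_add_neg, e1]
    push_cast
    ring
  rw [heq, Complex.norm_real] at hint
  exact (le_abs_self _).trans hint

theorem stmt7 {X : Type*} [NormedAddCommGroup X] [NormedSpace ℂ X] [CompleteSpace X]
    [Nontrivial X]
    (n : ℕ) (a : Fin (n + 1) → ℂ) (r : Fin (n + 1) → ℂ)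
    (hroot : ∀ k, r k ^ (n + 1) + ∑ j : Fin (n + 1), a j * r k ^ (n - (j : ℕ)) = 0)
    (hinj : Function.Injective r)
    (p : ℕ) (hp1 : 1 ≤ p) (hpn : p ≤ n)
    (hpos : ∀ k : Fin (n + 1), (k : ℕ) < p → 0 < (r k).re)
    (hneg : ∀ k : Fin (n + 1), p ≤ (k : ℕ) → (r k).re < 0)
    (KD : ℝ)
    (hKD : KD = (1 / ‖(Matrix.vandermonde r).det‖) *
      ∫ x in Set.Ioi (0 : ℝ),
        (‖∑ k ∈ Finset.univ.filter (fun k : Fin (n + 1) => (k : ℕ) < p),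
            (-1 : ℂ) ^ ((k : ℕ) + 1) * VandDel r k * Complex.exp (-(r k) * x)‖ +
         ‖∑ k ∈ Finset.univ.filter (fun k : Fin (n + 1) => p ≤ (k : ℕ)),
            (-1 : ℂ) ^ ((k : ℕ) + 1) * VandDel r k * Complex.exp (r k * x)‖)) :
    IsUlamConstant (X := X) (n + 1) a KD ∧
      ∀ K : ℝ, IsUlamConstant (X := X) (n + 1) a K → KD ≤ K := by
  set c := Lagrange.nodalWeight Finset.univ r with hc
  set A : ℝ → ℂ := fun x => ∑ k ∈ Finset.univ.filter (fun k : Fin (n + 1) => (k : ℕ) < p),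
    c k * Complex.exp (-(r k) * x) with hA
  set B : ℝ → ℂ := fun x => ∑ k ∈ Finset.univ.filter (fun k : Fin (n + 1) => p ≤ (k : ℕ)),
    c k * Complex.exp (r k * x) with hB
  have hAc : Continuous A := by fun_prop
  have hBc : Continuous B := by fun_prop
  have hAi : IntegrableOn A (Set.Ioi 0) := integrableOn_sum_exp _ _ _ fun k hk => by
    simpa using hpos k (Finset.mem_filter.1 hk).2
  have hBi : IntegrableOn B (Set.Ioi 0) := integrableOn_sum_exp _ _ _ fun k hk =>
    hneg k (Finset.mem_filter.1 hk).2
  have hKD' : KD = ∫ x in Set.Ioi (0 : ℝ), (‖A x‖ + ‖B x‖) := by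
    have hV : ‖(Matrix.vandermonde r).det‖ ≠ 0 :=
      norm_ne_zero_iff.2 (Matrix.det_vandermonde_ne_zero_iff.2 hinj)
    rw [hKD, one_div, inv_mul_eq_iff_eq_mul₀ hV, ← integral_const_mul]
    refine integral_congr_ae (Eventually.of_forall fun x => ?_)
    simp only [neg_one_pow_mul_vandDel hinj, mul_assoc, ← Finset.mul_sum, norm_mul, norm_pow,
      norm_neg, norm_one, one_pow, one_mul, ← mul_add, hA, hB, hc]
  have hre : ∀ k, (r k).re ≠ 0 := fun k => by
    rcases Nat.lt_or_ge k p with h | h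
    · exact (hpos k h).ne'
    · exact (hneg k h).ne
  have hsol : ∀ (f : ℝ → X), Continuous f → ∀ ε, (∀ t, ‖f t‖ ≤ ε) →
      ∃ y : ℝ → X, ContDiff ℝ (n + 1 : ℕ) y ∧ Dop (n + 1) a y = f ∧
        (∀ t, y t = ∫ x in Set.Ioi (0 : ℝ), (B x • f (t - x) - A x • f (t + x))) ∧
        ∀ t, ‖y t‖ ≤ KD * ε := by
    intro f hf ε hε
    obtain ⟨y, hy, hDy, hyt⟩ := exists_Dop_eq_and_eq_integral hroot hinj hpos hneg hf hε
    refine ⟨y, hy, hDy, hyt, fun t => ?_⟩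
    rw [hyt t, hKD', ← integral_mul_const]
    refine norm_integral_le_of_norm_le ((hAi.norm.add hBi.norm).mul_const ε)
      (Eventually.of_forall fun x => ?_)
    refine (norm_sub_le _ _).trans ?_
    rw [norm_smul, norm_smul, add_comm, add_mul]
    exact add_le_add (mul_le_mul_of_nonneg_left (hε _) (norm_nonneg _))
      (mul_le_mul_of_nonneg_left (hε _) (norm_nonneg _))
  have hsub : ∀ y z : ℝ → X, ContDiff ℝ (n + 1 : ℕ) y → ContDiff ℝ (n + 1 : ℕ) z →
      Dop (n + 1) a (y - z) = Dop (n + 1) a y - Dop (n + 1) a z := by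
    intro y z hy hz
    funext t
    have h : ∀ m ≤ n + 1, iteratedDeriv m (y - z) t = iteratedDeriv m y t - iteratedDeriv m z t :=
      fun m hm => iteratedDeriv_sub (hy.of_le (by exact_mod_cast hm)).contDiffAt
        (hz.of_le (by exact_mod_cast hm)).contDiffAt
    have hlow : ∀ j : Fin (n + 1), iteratedDeriv (n + 1 - 1 - (j : ℕ)) (y - z) t =
        iteratedDeriv (n + 1 - 1 - (j : ℕ)) y t - iteratedDeriv (n + 1 - 1 - (j : ℕ)) z t :=
      fun j => h _ (by omega)
    simp only [Dop, Pi.sub_apply, h _ le_rfl, hlow, smul_sub, Finset.sum_sub_distrib]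
    abel
  refine ⟨⟨?_, fun ε hε y hy hDy => ?_⟩, fun K hK => ?_⟩
  · rw [hKD']
    exact integral_nonneg fun x => by positivity
  · have hcont : Continuous (Dop (n + 1) a y) := by
      have h : ∀ m ≤ n + 1, Continuous (iteratedDeriv m y) := fun m hm =>
        hy.continuous_iteratedDeriv m (by exact_mod_cast hm)
      exact (h _ le_rfl).add (continuous_finsetSum _ fun j _ =>
        (h _ (show n + 1 - 1 - (j : ℕ) ≤ n + 1 by omega)).const_smul (a j))
    obtain ⟨u, hu, hDu, -, hbound⟩ := hsol _ hcont ε hDy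
    refine ⟨y - u, hy.sub hu, by rw [hsub y u hy hu, hDu, sub_self], fun t => ?_⟩
    rw [Pi.sub_apply, sub_sub_cancel]
    exact hbound t
  · rw [hKD']
    obtain ⟨e, he⟩ := exists_ne (0 : X)
    set u : X := ((‖e‖⁻¹ : ℝ) : ℂ) • e
    have hu : ‖u‖ = 1 := by
      simp only [u]
      rw [norm_smul, Complex.norm_real, norm_inv, norm_norm,
        inv_mul_cancel₀ (norm_ne_zero_iff.2 he)]
    have h0 : A 0 + B 0 = 0 := by
      have h := sum_nodalWeight_mul_pow hinj (Nat.zero_le n)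
      rw [if_neg (by omega), ← Finset.sum_filter_add_sum_filter_not Finset.univ
        (fun k : Fin (n + 1) => (k : ℕ) < p)] at h
      simpa [hA, hB] using h
    refine integral_norm_add_norm_le hAc hBc hAi hBi h0 fun φ hφ hφ1 => ?_
    have hf1 : ∀ t, ‖φ t • u‖ ≤ 1 := fun t => by rw [norm_smul, hu, mul_one]; exact hφ1 t
    obtain ⟨y, hy, hDy, hyt, hbound⟩ := hsol (fun t => φ t • u) (by fun_prop) 1 hf1
    obtain ⟨z, hz, hDz, hyz⟩ := hK.2 1 one_pos y hy fun t => by rw [hDy]; exact hf1 t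
    have hz0 := eq_zero_of_bounded_of_Dop_eq_zero hroot hinj hre hz hDz
      (M := KD * 1 + K * 1) (fun t => by
        rw [← sub_sub_self (y t) (z t)]
        exact (norm_sub_le _ _).trans (add_le_add (hbound t) (hyz t))) 0
    have hy0 := hyz 0
    rw [hz0, sub_zero, mul_one, hyt 0] at hy0
    have hint : ∫ x in Set.Ioi (0 : ℝ), (B x • φ (0 - x) • u - A x • φ (0 + x) • u) =
        (∫ x in Set.Ioi (0 : ℝ), (B x * φ (-x) - A x * φ x)) • u := by
      rw [← integral_smul_const]
      simp only [zero_sub, zero_add, sub_smul, mul_smul]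
    rwa [hint, norm_smul, hu, mul_one] at hy0
end

section
/- Suppose the characteristic equation P(z)=0 has n real, distinct roots r₁,…,rₙ and aₙ ≠ 0 (equivalently, all r_k are nonzero). Then the best Ulam constant of D equals 1/|r₁r₂⋯rₙ| = 1/|aₙ|; that is, 1/|aₙ| is an Ulam constant of D and every Ulam constant K of D satisfies K ≥ 1/|aₙ|. -/
open MeasureTheory

open Polynomial in
/-- The value at `t` of the constant-coefficient operator `p(d/dt)` applied to `y`,
as a linear function of the polynomial `p`. -/
noncomputable def diffOp {E : Type*} [NormedAddCommGroup E] [NormedSpace ℂ E]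
    (y : ℝ → E) (t : ℝ) : ℂ[X] →ₗ[ℂ] E :=
  Polynomial.lsum fun i => LinearMap.toSpanSingleton ℂ E (iteratedDeriv i y t)

section DiffOp

open Polynomial

variable {E : Type*} [NormedAddCommGroup E] [NormedSpace ℂ E]

theorem diffOp_monomial (y : ℝ → E) (t : ℝ) (i : ℕ) (c : ℂ) :
    diffOp y t (monomial i c) = c • iteratedDeriv i y t := by
  simp [diffOp, sum_monomial_index]

theorem diffOp_C_mul_X_pow (y : ℝ → E) (t : ℝ) (i : ℕ) (c : ℂ) :
    diffOp y t (C c * X ^ i) = c • iteratedDeriv i y t := by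
  rw [C_mul_X_pow_eq_monomial, diffOp_monomial]

theorem diffOp_one (y : ℝ → E) (t : ℝ) : diffOp y t 1 = y t := by
  simpa using diffOp_monomial y t 0 1

theorem diffOp_eq_sum_range (y : ℝ → E) (t : ℝ) (p : ℂ[X]) :
    diffOp y t p = ∑ i ∈ Finset.range (p.natDegree + 1), p.coeff i • iteratedDeriv i y t := by
  simp only [diffOp, lsum_apply, LinearMap.toSpanSingleton_apply]
  exact sum_over_range _ (by simp)

theorem diffOp_mul_X (y : ℝ → E) (t : ℝ) (p : ℂ[X]) :
    diffOp y t (p * X) = diffOp (deriv y) t p := by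
  induction p using Polynomial.induction_on' with
  | add p q hp hq => rw [add_mul, map_add, map_add, hp, hq]
  | monomial i c =>
    rw [monomial_mul_X, diffOp_monomial, diffOp_monomial, iteratedDeriv_succ']

theorem diffOp_mul_X_sub_C (y : ℝ → E) (t : ℝ) (p : ℂ[X]) (c : ℂ) :
    diffOp y t (p * (X - C c)) = diffOp (deriv y) t p - c • diffOp y t p := by
  rw [mul_sub, map_sub, diffOp_mul_X, mul_comm p (C c), ← smul_eq_C_mul, map_smul]

theorem diffOp_sub_smul {y w : ℝ → E} {p : ℂ[X]} (hy : ContDiff ℝ p.natDegree y)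
    (hw : ContDiff ℝ p.natDegree w) (c : ℂ) (t : ℝ) :
    diffOp (fun s => y s - c • w s) t p = diffOp y t p - c • diffOp w t p := by
  simp only [diffOp_eq_sum_range, Finset.smul_sum, ← Finset.sum_sub_distrib]
  refine Finset.sum_congr rfl fun i hi => ?_
  have hle : (i : WithTop ℕ∞) ≤ p.natDegree := by
    exact_mod_cast Nat.lt_succ_iff.mp (Finset.mem_range.mp hi)
  have hyi := (hy.of_le hle).contDiffAt (x := t)
  have hwi := (hw.of_le hle).contDiffAt (x := t)
  rw [iteratedDeriv_fun_sub hyi (hwi.const_smul c), iteratedDeriv_fun_const_smul hwi c, smul_sub,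
    smul_comm c]

theorem diffOp_sub {y w : ℝ → E} {p : ℂ[X]} (hy : ContDiff ℝ p.natDegree y)
    (hw : ContDiff ℝ p.natDegree w) (t : ℝ) :
    diffOp (fun s => y s - w s) t p = diffOp y t p - diffOp w t p := by
  simpa using diffOp_sub_smul hy hw 1 t

theorem diffOp_comp_add_const (y : ℝ → E) (s t : ℝ) (p : ℂ[X]) :
    diffOp (fun τ => y (τ + s)) t p = diffOp y (t + s) p := by
  simp only [diffOp_eq_sum_range, iteratedDeriv_comp_add_const]

theorem hasDerivAt_diffOp {y : ℝ → E} {p : ℂ[X]} (hy : ContDiff ℝ (p.natDegree + 1 : ℕ) y)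
    (t : ℝ) : HasDerivAt (fun s => diffOp y s p) (diffOp (deriv y) t p) t := by
  simp only [diffOp_eq_sum_range]
  refine HasDerivAt.fun_sum fun i hi => ?_
  have hd : Differentiable ℝ (iteratedDeriv i y) :=
    hy.differentiable_iteratedDeriv i (by exact_mod_cast Finset.mem_range.mp hi)
  rw [← iteratedDeriv_succ', iteratedDeriv_succ]
  exact (hd t).hasDerivAt.const_smul _

theorem diffOp_const (x : E) (t : ℝ) (p : ℂ[X]) :
    diffOp (fun _ => x) t p = p.eval 0 • x := by
  rw [diffOp_eq_sum_range, Finset.sum_eq_single 0]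
  · simp [coeff_zero_eq_eval_zero]
  · intro i _ hi
    simp [iteratedDeriv_const, hi]
  · simp

/-- A solution of `v' = r v` is an exponential, so a unit time shift multiplies it by `exp r`. -/
theorem apply_add_one_of_hasDerivAt_smul {v : ℝ → E} {r : ℝ}
    (hv : ∀ t, HasDerivAt v (r • v t) t) (t : ℝ) : v (t + 1) = Real.exp r • v t := by
  have hexp (s : ℝ) : HasDerivAt (fun s => Real.exp (-(r * s))) (Real.exp (-(r * s)) * -r) s := by
    simpa using ((hasDerivAt_id s).const_mul r).neg.exp
  have hder (s : ℝ) : HasDerivAt (fun s => Real.exp (-(r * s)) • v s) 0 s := by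
    refine ((hexp s).smul (hv s)).congr_deriv ?_
    module
  have hconst := is_const_of_deriv_eq_zero (fun s => (hder s).differentiableAt)
    (fun s => (hder s).deriv) (t + 1) t
  have := congrArg (fun x => Real.exp (r * (t + 1)) • x) hconst
  simp only [smul_smul, ← Real.exp_add] at this
  ring_nf at this
  simpa [add_comm] using this

theorem eq_zero_of_apply_add_one_of_bounded {z : ℝ → E} {r B : ℝ} (hr : r ≠ 0)
    (hz : ∀ t, z (t + 1) = Real.exp r • z t) (hB : ∀ t, ‖z t‖ ≤ B) (t : ℝ) : z t = 0 := by
  have hpow (k : ℕ) (s : ℝ) : ‖z (s + k)‖ = Real.exp r ^ k * ‖z s‖ := by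
    induction k with
    | zero => simp
    | succ k ih =>
      rw [Nat.cast_succ, ← add_assoc, hz, norm_smul, ih, Real.norm_of_nonneg (Real.exp_pos r).le]
      ring
  by_contra hne
  have hpos : 0 < ‖z t‖ := norm_pos_iff.mpr hne
  rcases lt_or_gt_of_ne hr with hr | hr
  · obtain ⟨k, hk⟩ := pow_unbounded_of_one_lt (B / ‖z t‖) (Real.one_lt_exp_iff.mpr (neg_pos.mpr hr))
    have h1 := hpow k (t - k)
    rw [sub_add_cancel] at h1
    rw [div_lt_iff₀ hpos, h1, ← mul_assoc, ← mul_pow, ← Real.exp_add] at hk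
    simp only [neg_add_cancel, Real.exp_zero, one_pow, one_mul] at hk
    exact (hB _).not_gt hk
  · obtain ⟨k, hk⟩ := pow_unbounded_of_one_lt (B / ‖z t‖) (Real.one_lt_exp_iff.mpr hr)
    rw [div_lt_iff₀ hpos, ← hpow] at hk
    exact (hB _).not_gt hk

theorem natDegree_prod_X_sub_C_ofReal {ι : Type*} (s : Finset ι) (r : ι → ℝ) :
    (∏ i ∈ s, (X - C (r i : ℂ))).natDegree = s.card :=
  natDegree_finsetProd_X_sub_C_eq_card s fun i => (r i : ℂ)

/-- A bounded function annihilated by a differential operator with nonzero real characteristic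
roots vanishes. -/
theorem eq_zero_of_diffOp_prod_eq_zero {ι : Type*} (s : Finset ι) (r : ι → ℝ)
    (hr : ∀ i ∈ s, r i ≠ 0) {z : ℝ → E} {B : ℝ} (hz : ContDiff ℝ s.card z)
    (hB : ∀ t, ‖z t‖ ≤ B) (h0 : ∀ t, diffOp z t (∏ i ∈ s, (X - C (r i : ℂ))) = 0) (t : ℝ) :
    z t = 0 := by
  classical
  induction s using Finset.induction_on generalizing z B t with
  | empty => simpa [diffOp_one] using h0 t
  | insert i s hi ih =>
    set q : ℂ[X] := ∏ i ∈ s, (X - C (r i : ℂ)) with hq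
    have hdeg : q.natDegree = s.card := natDegree_prod_X_sub_C_ofReal s r
    rw [Finset.card_insert_of_notMem hi] at hz
    have hzs : ContDiff ℝ s.card z := hz.of_le (by exact_mod_cast Nat.le_succ _)
    have hshift : ContDiff ℝ s.card fun t => z (t + 1) := hzs.comp (contDiff_id.add contDiff_const)
    have hv (t : ℝ) : HasDerivAt (fun t => diffOp z t q) (r i • diffOp z t q) t := by
      have h := h0 t
      rw [Finset.prod_insert hi, mul_comm, diffOp_mul_X_sub_C, sub_eq_zero,
        Complex.coe_smul] at h
      rw [← h]
      exact hasDerivAt_diffOp (by rwa [hdeg]) t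
    refine eq_zero_of_apply_add_one_of_bounded (hr i (Finset.mem_insert_self i s)) (fun t => ?_) hB t
    rw [← sub_eq_zero, ← Complex.coe_smul]
    refine ih (fun j hj => hr j (Finset.mem_insert_of_mem hj))
      (z := fun t => z (t + 1) - (Real.exp (r i) : ℂ) • z t) (B := B + Real.exp (r i) * B)
      (hshift.sub (hzs.const_smul _)) (fun t => ?_) (fun t => ?_) t
    · refine (norm_sub_le _ _).trans (add_le_add (hB _) ?_)
      rw [Complex.coe_smul, norm_smul, Real.norm_of_nonneg (Real.exp_pos _).le]
      gcongr
      exact hB t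
    · rw [diffOp_sub_smul (by rwa [hdeg]) (by rwa [hdeg]), diffOp_comp_add_const,
        apply_add_one_of_hasDerivAt_smul hv, Complex.coe_smul, sub_self]

theorem exists_bounded_hasDerivAt_of_pos [CompleteSpace E] {r B : ℝ} (hr : 0 < r) {f : ℝ → E}
    (hf : Continuous f) (hB : ∀ t, ‖f t‖ ≤ B) :
    ∃ u : ℝ → E, (∀ t, HasDerivAt u (r • u t + f t) t) ∧ ∀ t, ‖u t‖ ≤ B / r := by
  have hcont : Continuous fun s => Real.exp (-r * s) • f s := by fun_prop
  have hle (s : ℝ) : ‖Real.exp (-r * s) • f s‖ ≤ Real.exp (-r * s) * B := by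
    rw [norm_smul, Real.norm_of_nonneg (Real.exp_pos _).le]
    gcongr
    exact hB s
  have hdom (t : ℝ) : IntegrableOn (fun s => Real.exp (-r * s) * B) (Set.Ioi t) :=
    (exp_neg_integrableOn_Ioi t hr).mul_const B
  have hint (t : ℝ) : IntegrableOn (fun s => Real.exp (-r * s) • f s) (Set.Ioi t) :=
    (hdom t).mono' hcont.aestronglyMeasurable (Filter.Eventually.of_forall hle)
  have heq (t : ℝ) : ∫ s in Set.Ioi t, Real.exp (-r * s) • f s =
      (∫ s in Set.Ioi (0 : ℝ), Real.exp (-r * s) • f s) -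
        ∫ s in (0 : ℝ)..t, Real.exp (-r * s) • f s := by
    rw [← intervalIntegral.integral_interval_add_Ioi (hint 0) (hint t), add_sub_cancel_left]
  have hcancel (t : ℝ) : Real.exp (r * t) * Real.exp (-r * t) = 1 := by
    rw [← Real.exp_add]
    simp
  refine ⟨fun t => -(Real.exp (r * t) • ∫ s in Set.Ioi t, Real.exp (-r * s) • f s),
    fun t => ?_, fun t => ?_⟩
  · have hexp : HasDerivAt (fun t => Real.exp (r * t)) (Real.exp (r * t) * r) t := by
      simpa using ((hasDerivAt_id t).const_mul r).exp
    have htail : HasDerivAt (fun t => ∫ s in Set.Ioi t, Real.exp (-r * s) • f s)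
        (-(Real.exp (-r * t) • f t)) t := by
      rw [funext heq]
      exact ((hcont.integral_hasStrictDerivAt 0 t).hasDerivAt).const_sub _
    refine (hexp.smul htail).neg.congr_deriv ?_
    rw [smul_neg, smul_smul, hcancel]
    module
  · rw [norm_neg, norm_smul, Real.norm_of_nonneg (Real.exp_pos _).le]
    calc Real.exp (r * t) * ‖∫ s in Set.Ioi t, Real.exp (-r * s) • f s‖
        ≤ Real.exp (r * t) * ∫ s in Set.Ioi t, Real.exp (-r * s) * B := by
          gcongr
          exact norm_integral_le_of_norm_le (hdom t) (Filter.Eventually.of_forall hle)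
      _ = Real.exp (r * t) * Real.exp (-r * t) * (B / r) := by
          rw [integral_mul_const, integral_exp_mul_Ioi (neg_neg_of_pos hr)]
          field_simp
      _ = B / r := by rw [hcancel, one_mul]

theorem exists_bounded_hasDerivAt [CompleteSpace E] {r B : ℝ} (hr : r ≠ 0) {f : ℝ → E}
    (hf : Continuous f) (hB : ∀ t, ‖f t‖ ≤ B) :
    ∃ u : ℝ → E, (∀ t, HasDerivAt u (r • u t + f t) t) ∧ ∀ t, ‖u t‖ ≤ B / |r| := by
  rcases lt_or_gt_of_ne hr with hr | hr
  · obtain ⟨u, hu, hle⟩ := exists_bounded_hasDerivAt_of_pos (neg_pos.mpr hr)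
      (f := fun t => -f (-t)) (B := B) (by fun_prop) (fun t => by simpa using hB (-t))
    refine ⟨fun t => u (-t), fun t => ?_, fun t => by simpa [abs_of_neg hr] using hle (-t)⟩
    refine ((hu (-t)).scomp t (hasDerivAt_neg t)).congr_deriv ?_
    simp
  · simpa [abs_of_pos hr] using exists_bounded_hasDerivAt_of_pos hr hf hB

theorem contDiff_succ_of_hasDerivAt_smul_add {r : ℝ} {f u : ℝ → E} {m : ℕ}
    (hf : ContDiff ℝ m f) (hu : ∀ t, HasDerivAt u (r • u t + f t) t) :
    ContDiff ℝ (m + 1 : ℕ) u := by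
  have hdiff : Differentiable ℝ u := fun t => (hu t).differentiableAt
  have hderiv : deriv u = fun t => r • u t + f t := funext fun t => (hu t).deriv
  have step {k : ℕ} (hk : k ≤ m) (huk : ContDiff ℝ k u) : ContDiff ℝ (k + 1 : ℕ) u := by
    rw [Nat.cast_succ, contDiff_succ_iff_deriv, hderiv]
    refine ⟨hdiff, by simp, (huk.const_smul r).add (hf.of_le (by exact_mod_cast hk))⟩
  have key (k : ℕ) (hk : k ≤ m) : ContDiff ℝ (k + 1 : ℕ) u := by
    induction k with
    | zero => exact step hk (contDiff_zero.mpr hdiff.continuous)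
    | succ k ih => exact step hk (ih (Nat.le_of_succ_le hk))
  exact key m le_rfl

/-- A differential operator with nonzero real characteristic roots has a right inverse on bounded
continuous functions, of norm at most the inverse of the product of the absolute values of the
roots. -/
theorem exists_bounded_diffOp_prod_eq [CompleteSpace E] {ι : Type*} (s : Finset ι) (r : ι → ℝ)
    (hr : ∀ i ∈ s, r i ≠ 0) {f : ℝ → E} {B : ℝ} (hf : Continuous f) (hB : ∀ t, ‖f t‖ ≤ B) :
    ∃ w : ℝ → E, ContDiff ℝ s.card w ∧ (∀ t, diffOp w t (∏ i ∈ s, (X - C (r i : ℂ))) = f t) ∧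
      ∀ t, ‖w t‖ ≤ B / |∏ i ∈ s, r i| := by
  classical
  induction s using Finset.induction_on with
  | empty => exact ⟨f, contDiff_zero.mpr hf, by simp [diffOp_one], by simpa using hB⟩
  | insert i s hi ih =>
    obtain ⟨v, hv, hvf, hvB⟩ := ih fun j hj => hr j (Finset.mem_insert_of_mem hj)
    obtain ⟨u, hu, huB⟩ :=
      exists_bounded_hasDerivAt (hr i (Finset.mem_insert_self i s)) hv.continuous hvB
    have hus : ContDiff ℝ (s.card + 1 : ℕ) u := contDiff_succ_of_hasDerivAt_smul_add hv hu
    have hderiv : ContDiff ℝ s.card (deriv u) := by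
      rw [Nat.cast_succ, contDiff_succ_iff_deriv] at hus
      exact hus.2.2
    have hdeg := natDegree_prod_X_sub_C_ofReal s r
    refine ⟨u, by rwa [Finset.card_insert_of_notMem hi], fun t => ?_, fun t => ?_⟩
    · rw [Finset.prod_insert hi, mul_comm, diffOp_mul_X_sub_C, ← diffOp_sub_smul (by rwa [hdeg])
        (by rw [hdeg]; exact hus.of_le (by exact_mod_cast Nat.le_succ _)), ← hvf t]
      congr 2
      funext τ
      rw [(hu τ).deriv, Complex.coe_smul, add_sub_cancel_left]
    · rw [Finset.prod_insert hi, abs_mul, mul_comm, ← div_div]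
      exact huB t

theorem Dop_eq_diffOp (n : ℕ) (a : Fin (n + 1) → ℂ) (y : ℝ → E) (t : ℝ) :
    Dop (n + 1) a y t = diffOp y t (X ^ (n + 1) + ∑ j : Fin (n + 1), C (a j) * X ^ (n - (j : ℕ))) := by
  have h := diffOp_C_mul_X_pow y t (n + 1) 1
  rw [C_1, one_mul, one_smul] at h
  simp [Dop, h, diffOp_C_mul_X_pow]

theorem eq_prod_X_sub_C_of_roots (n : ℕ) (a r : Fin (n + 1) → ℂ)
    (hroot : ∀ k, r k ^ (n + 1) + ∑ j : Fin (n + 1), a j * r k ^ (n - (j : ℕ)) = 0)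
    (hinj : Function.Injective r) :
    X ^ (n + 1) + ∑ j : Fin (n + 1), C (a j) * X ^ (n - (j : ℕ)) = ∏ k, (X - C (r k)) := by
  have hlow : (∑ j : Fin (n + 1), C (a j) * X ^ (n - (j : ℕ))).degree < ((n + 1 : ℕ) : WithBot ℕ) := by
    refine (degree_sum_le _ _).trans_lt ((Finset.sup_lt_iff (WithBot.bot_lt_coe _)).mpr fun j _ => ?_)
    refine (degree_C_mul_X_pow_le _ _).trans_lt ?_
    exact_mod_cast Nat.lt_succ_of_le (Nat.sub_le _ _)
  have hmonic : (X ^ (n + 1) + ∑ j : Fin (n + 1), C (a j) * X ^ (n - (j : ℕ))).Monic :=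
    monic_X_pow_add hlow
  have hprod : (∏ k, (X - C (r k))).Monic := monic_prod_of_monic _ _ fun k _ => monic_X_sub_C _
  have hdeg : (X ^ (n + 1) + ∑ j : Fin (n + 1), C (a j) * X ^ (n - (j : ℕ))).degree =
      ((n + 1 : ℕ) : WithBot ℕ) := by
    rw [degree_add_eq_left_of_degree_lt (by simpa using hlow), degree_X_pow]
  have hdeg' : (∏ k, (X - C (r k))).degree = ((n + 1 : ℕ) : WithBot ℕ) := by
    rw [degree_eq_natDegree hprod.ne_zero, natDegree_finsetProd_X_sub_C_eq_card]
    simp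
  refine eq_of_degree_sub_lt_of_eval_index_eq Finset.univ hinj.injOn ?_ fun k _ => ?_
  · refine (degree_sub_lt_left (hdeg.trans hdeg'.symm) hmonic.ne_zero
      (hmonic.leadingCoeff.trans hprod.leadingCoeff.symm)).trans_eq ?_
    rw [hdeg]
    simp
  · have : ∏ j, (r k - r j) = 0 := Finset.prod_eq_zero (Finset.mem_univ k) (sub_self _)
    simpa [eval_finsetSum, eval_prod, this] using hroot k

end DiffOp

theorem stmt8 {X : Type*} [NormedAddCommGroup X] [NormedSpace ℂ X] [CompleteSpace X]
    [Nontrivial X]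
    (n : ℕ) (a : Fin (n + 1) → ℂ) (r : Fin (n + 1) → ℝ)
    (hroot : ∀ k, (r k : ℂ) ^ (n + 1) +
      ∑ j : Fin (n + 1), a j * (r k : ℂ) ^ (n - (j : ℕ)) = 0)
    (hinj : Function.Injective r)
    (han : a (Fin.last n) ≠ 0) :
    1 / |∏ k : Fin (n + 1), r k| = 1 / ‖a (Fin.last n)‖ ∧
    IsUlamConstant (X := X) (n + 1) a (1 / ‖a (Fin.last n)‖) ∧
      ∀ K : ℝ, IsUlamConstant (X := X) (n + 1) a K → 1 / ‖a (Fin.last n)‖ ≤ K := by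
  have hP := eq_prod_X_sub_C_of_roots n a (fun k => (r k : ℂ)) hroot
    (Complex.ofReal_injective.comp hinj)
  set p : Polynomial ℂ := ∏ k, (Polynomial.X - Polynomial.C (r k : ℂ)) with hp
  have hD (y : ℝ → X) (t : ℝ) : Dop (n + 1) a y t = diffOp y t p := by
    rw [Dop_eq_diffOp, hP]
  have hdeg : p.natDegree = n + 1 := by
    rw [hp, natDegree_prod_X_sub_C_ofReal, Finset.card_fin]
  have heval : p.eval 0 = a (Fin.last n) := by
    rw [← hP]
    simp only [Polynomial.eval_add, Polynomial.eval_pow, Polynomial.eval_X, Polynomial.eval_mul,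
      Polynomial.eval_C, Polynomial.eval_finsetSum]
    rw [Finset.sum_eq_single (Fin.last n)]
    · simp
    · intro j _ hj
      have hlt : (j : ℕ) < n := Fin.val_lt_last hj
      simp [zero_pow (Nat.sub_pos_of_lt hlt).ne']
    · simp
  have habs : |∏ k, r k| = ‖a (Fin.last n)‖ := by
    rw [← heval, hp, Polynomial.eval_prod, norm_prod, Finset.abs_prod]
    simp
  have hr (k : Fin (n + 1)) : r k ≠ 0 := by
    have : ∏ k, r k ≠ 0 := abs_ne_zero.mp (habs ▸ norm_ne_zero_iff.mpr han)
    exact Finset.prod_ne_zero_iff.mp this k (Finset.mem_univ k)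
  have hpos : 0 < ‖a (Fin.last n)‖ := norm_pos_iff.mpr han
  refine ⟨by rw [habs], ⟨by positivity, fun ε _ y hy hyε => ?_⟩, fun K ⟨_, hK⟩ => ?_⟩
  · have hcont : Continuous (Dop (n + 1) a y) := by
      simp only [funext (hD y), diffOp_eq_sum_range]
      refine continuous_finsetSum _ fun i hi => (hy.continuous_iteratedDeriv i ?_).const_smul _
      rw [hdeg] at hi
      exact_mod_cast Nat.lt_succ_iff.mp (Finset.mem_range.mp hi)
    obtain ⟨w, hw, hwf, hwB⟩ :=
      exists_bounded_diffOp_prod_eq Finset.univ r (fun k _ => hr k) hcont hyε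
    rw [Finset.card_fin] at hw
    refine ⟨fun t => y t - w t, hy.sub hw, funext fun t => ?_, fun t => ?_⟩
    · rw [hD, diffOp_sub (by rwa [hdeg]) (by rwa [hdeg]), hwf, hD, sub_self, Pi.zero_apply]
    · rw [sub_sub_cancel, one_div_mul_eq_div, ← habs]
      exact hwB t
  · obtain ⟨x, hx⟩ := exists_norm_eq X (c := 1 / ‖a (Fin.last n)‖) (by positivity)
    obtain ⟨z, hz, hz0, hzK⟩ := hK 1 one_pos (fun _ => x) contDiff_const fun t => by
      rw [hD, diffOp_const, heval, norm_smul, hx, mul_one_div_cancel hpos.ne']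
    have hbdd (t : ℝ) : ‖z t‖ ≤ ‖x‖ + K * 1 := by
      have := (norm_sub_le x (x - z t)).trans (add_le_add_right (hzK t) _)
      rwa [sub_sub_cancel] at this
    have hzero := eq_zero_of_diffOp_prod_eq_zero Finset.univ r (fun k _ => hr k)
      (by rwa [Finset.card_fin]) hbdd (fun t => by rw [← hp, ← hD, hz0, Pi.zero_apply]) 0
    simpa [hzero, hx] using hzK 0
end
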